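/- Any two tournaments on 25 vertices that contain no transitive subtournament of size 6 are isomorphic; that is, if r and s are tournaments on Fin 25, each TT_6-free, then there exists a bijection g : Fin 25 → Fin 25 such that for all u, v, r u v holds if and only if s (g u) (g v) holds. -/

import Mathlib

/-- A tournament: an irreflexive relation such that for distinct vertices
exactly one direction of the edge is present. -/
def IsTournament {V : Type*} (r : V → V → Prop) : Prop :=
  (∀ v, ¬ r v v) ∧ ∀ u v : V, u ≠ v → Xor' (r u v) (r v u)

/-- The tournament `r` contains a transitive subtournament of size `k`. -/
def HasTT {V : Type*} (r : V → V → Prop) (k : ℕ) : Prop :=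
  ∃ f : Fin k → V, Function.Injective f ∧ ∀ i j : Fin k, i < j → r (f i) (f j)

namespace TTFree

/-- Evaluate `n` before passing it to `k`. -/
def force {α : Type} (n : ℕ) (k : ℕ → α) : α :=
  Nat.rec (k 0) (fun m _ => k (Nat.succ m)) n

/-- `a` if `n = 0`, and `b` otherwise. -/
def ifz {α : Type} (n : ℕ) (a b : α) : α := Nat.rec a (fun _ _ => b) n

/-- The bits of `x` that are not bits of `y`. -/
def diff (x y : ℕ) : ℕ := Nat.xor x (Nat.land x y)

/-- The mask with the bits below `W`. -/
def full (W : ℕ) : ℕ := Nat.sub (Nat.pow 2 W) 1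

/-- The position of the bit in a power of two below `2 ^ 32`. -/
def idx (b : ℕ) : ℕ :=
  Nat.land 31 (Nat.shiftRight 28507754684909926779703069327497961803097624868629054464 (Nat.mul 5 (Nat.mod b 37)))

/-- The position of the lowest bit of `x`, for `0 < x < 2 ^ 32`. -/
def low (x : ℕ) : ℕ := idx (Nat.xor x (Nat.land x (Nat.sub x 1)))

/-- The position, from `t` on, of a bit of `P` in a window of length `2 ^ n`. -/
def find (P : ℕ) (n : ℕ) : ℕ → ℕ :=
  Nat.rec (fun t => t)
    (fun i ih t => ifz (Nat.shiftRight P (Nat.add t (Nat.pow 2 i))) (ih t) (force (Nat.add t (Nat.pow 2 i)) ih)) n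

/-- Remove from `al` the indices of `G` that occur in some column of `C` listed in `x`. -/
def leafLoop (S C G : ℕ) (fuel : ℕ) : ℕ → ℕ → ℕ :=
  Nat.rec (fun _ al => al)
    (fun _ rec x al => Nat.rec (motive := fun _ => ℕ) al (fun _ _ => Nat.rec (motive := fun _ => ℕ) al (fun _ _ =>
        rec (Nat.land x (Nat.sub x 1)) (diff al (Nat.land G (Nat.shiftRight C (Nat.mul S (low x))))))
       (Nat.land G al)) x) fuel

/-- Extend the current chain of the search `ih` by the base vertex `a`. -/
def dfsStep (ih : ℕ → ℕ → ℕ → ℕ → ℕ) (O c E al : ℕ) (a G' : ℕ) : ℕ :=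
  ih (Nat.land c (Nat.shiftRight O (Nat.mul 32 (Nat.succ a)))) (diff (Nat.land E al) G') G' al

/-- Extend the current chain by each of the base vertices in `x`, starting from the columns in
`C`; the indices of `E` may follow the chain, those of `G` may be inserted in it. -/
def dfsLoop (ih : ℕ → ℕ → ℕ → ℕ → ℕ) (S C O c : ℕ) (fuel : ℕ) : ℕ → ℕ → ℕ → ℕ → ℕ :=
  Nat.rec (fun _ _ _ al => al)
    (fun _ rec x E G al =>
      Nat.rec (motive := fun _ => ℕ) al (fun _ _ => Nat.rec (motive := fun _ => ℕ) al (fun _ _ =>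
              rec (Nat.land x (Nat.sub x 1)) E G
                (dfsStep ih O c E al (low x) (Nat.land (Nat.shiftRight C (Nat.mul S (low x))) (Nat.land al (Nat.lor E G))))) (Nat.land al (Nat.lor E G))) x) fuel

/-- Remove from `al` the indices of the vertices that form a transitive subtournament with the
current chain and `k` further base vertices, taken from the candidates `c`. -/
def dfs (S C O : ℕ) (k : ℕ) : ℕ → ℕ → ℕ → ℕ → ℕ :=
  Nat.rec (fun c E G al => Nat.rec (motive := fun _ => ℕ) al (fun _ _ => leafLoop S C G 32 c (diff al E)) c)
    (fun _ ih c E G al => Nat.rec (motive := fun _ => ℕ) al (fun _ _ => dfsLoop ih S C O c 32 c E G al) (Nat.land c (Nat.sub c 1))) k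

/-- The search `dfs`, restricted to the transitive subtournaments that contain the vertex `p`. -/
def dfsP (S C O p I : ℕ) (k : ℕ) : ℕ → ℕ → ℕ → ℕ → ℕ :=
  Nat.rec (fun _ E G al => diff al (Nat.lor E (Nat.land G (Nat.shiftRight C (Nat.mul S p)))))
    (fun k ih c E G al => dfsLoop ih S C O c 32 (Nat.land c I) E G
      (dfs S C O k (Nat.land c (Nat.shiftRight O (Nat.mul 32 (Nat.succ p))))
                  (diff E (Nat.shiftRight C (Nat.mul S p)))
                  (Nat.land (Nat.lor E G) (Nat.shiftRight C (Nat.mul S p))) al)) k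

/-- The in-neighbours of `p` among the first `n` vertices of the table `O`. -/
def inRow (O p : ℕ) (n : ℕ) : ℕ :=
  Nat.rec 0 (fun i acc => Nat.lor acc
    (Nat.shiftLeft (Nat.land 1 (Nat.shiftRight O (Nat.add (Nat.mul 32 (Nat.succ i)) p))) i)) n

/-- The table `O` with an otherwise unused first row that distinguishes the values of `t`. -/
def tag (O t : ℕ) : ℕ := Nat.lor (Nat.shiftLeft (Nat.shiftRight O 32) 32) (Nat.land 4294967295 (Nat.add (Nat.mul 7919 (Nat.succ t)) (Nat.mul 1000003 O)))

/-- Record in `O` the arcs between the vertex `p` and the first `n` vertices, as described by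
index `t` of the table `C`. -/
def addRow (S C t p : ℕ) (n : ℕ) (O : ℕ) : ℕ :=
  Nat.rec O (fun i O =>
    ifz (Nat.land 1 (Nat.shiftRight C (Nat.add (Nat.mul S i) t)))
      (Nat.lor O (Nat.pow 2 (Nat.add (Nat.mul 32 (Nat.succ i)) p)))
      (Nat.lor O (Nat.pow 2 (Nat.add (Nat.mul 32 (Nat.succ p)) i)))) n

/-- Whether `u` has at least `n` bits. -/
def atLeast (n : ℕ) : ℕ → Bool :=
  Nat.rec (fun _ => true)
    (fun _ ih u => ifz u false (force (Nat.land u (Nat.sub u 1)) ih)) n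

/-- Identify the indices of `P` that agree modulo `W`, for a width `W * 2 ^ d`. -/
def fold (W : ℕ) (d : ℕ) : ℕ → ℕ :=
  Nat.rec (fun P => P) (fun d ih P =>
    force (Nat.lor (Nat.shiftRight P (Nat.mul W (Nat.pow 2 d)))
      (Nat.land P (full (Nat.mul W (Nat.pow 2 d))))) ih) d

/-- Double the width `w` of the table `C` and add a column `p` that is full on the second half. -/
def dbl (S w p C : ℕ) : ℕ :=
  Nat.lor (Nat.lor C (Nat.shiftLeft C w)) (Nat.shiftLeft (full w) (Nat.add (Nat.mul S p) w))

/-- The indices of `P` whose vertices do not form a forbidden transitive subtournament with the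
base vertices up to `p`, among those subtournaments that contain `p`. -/
def kill (S k O p C P : ℕ) : ℕ :=
  dfsP S C O p (inRow O p p) k (full (Nat.succ p)) P 0 P

/-- Apply `ref` after a vertex of index `t` is added to the base as vertex `p`. -/
def child (S k w p C C' O : ℕ) (ref : ℕ → ℕ → Bool) (P t : ℕ) : Bool :=
  force (addRow S C t p p (tag O t)) fun Q =>
    force (kill S k Q p C' (Nat.lor P (Nat.shiftLeft P w))) (ref Q)

/-- Branch on the next vertex of the base, as long as `P` leaves at least `need` residues. -/
def refuteLoop (S k W need d w p C C' O : ℕ) (ref : ℕ → ℕ → Bool) (fuel : ℕ) : ℕ → Bool :=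
  Nat.rec (fun _ => false)
    (fun _ rec P =>
      Bool.rec true
        (force (find P 13 0) fun t => force (Nat.xor P (Nat.pow 2 t)) fun P' =>
          Bool.rec false (rec P') (child S k w p C C' O ref P' t))
        (force (fold W d P) (atLeast need))) fuel

/-- Whether at most `depth` branchings show that no `need` distinct vertices have indices in `P`. -/
def refute (S k W : ℕ) (depth : ℕ) : ℕ → ℕ → ℕ → ℕ → ℕ → ℕ → ℕ → Bool :=
  Nat.rec (fun _ _ _ _ _ _ _ => false)
    (fun _ ih need d w p C O => force (dbl S w p C) fun C' =>
      refuteLoop S k W need d w p C C' O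
        (ih (Nat.sub need 1) (Nat.succ d) (Nat.mul 2 w) (Nat.succ p) C') 100000) depth

/-- The bits of `t` below `m`, placed at distance `S`. -/
def spread (S t : ℕ) (m : ℕ) : ℕ :=
  Nat.rec 0 (fun a acc => Nat.lor acc
    (Nat.shiftLeft (Nat.land 1 (Nat.shiftRight t a)) (Nat.mul S a))) m

/-- The table, with `m` columns and stride `S`, whose indices are the positions in `l`. -/
def cols (S m : ℕ) (l : List ℕ) : ℕ :=
  List.rec 0 (fun t _ ih => Nat.lor (spread S t m) (Nat.shiftLeft ih 1)) l

/-- The length of a list. -/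
def len (l : List ℕ) : ℕ := List.rec 0 (fun _ _ n => Nat.succ n) l

/-- Apply `cont` to the list of the bits of `P`. -/
def withBits (cont : List ℕ → Bool) (fuel : ℕ) : ℕ → List ℕ → Bool :=
  Nat.rec (fun _ _ => false)
    (fun _ ih P l => ifz P (cont (List.reverse l))
      (force (find P 13 0) fun t => force (Nat.xor P (Nat.pow 2 t)) fun P' => ih P' (t :: l))) fuel

/-- The table, with `m` columns, whose indices are all the types below `2 ^ m`. -/
def dense (S m : ℕ) : ℕ := Nat.rec 0 (fun i C => dbl S (Nat.pow 2 i) i C) m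

/-- Add to a table of width `W` a full column `m`. -/
def addTop (S W m C : ℕ) : ℕ := Nat.lor C (Nat.shiftLeft (full W) (Nat.mul S m))

/-- The types of a vertex over the base `O` that create no transitive subtournament. -/
def start (S k m O : ℕ) : ℕ :=
  force (addTop S (Nat.pow 2 m) m (dense S m)) fun C =>
    dfs S C (Nat.shiftLeft O 32) k (full (Nat.succ m)) (full (Nat.pow 2 m)) 0 (full (Nat.pow 2 m))

/-- The table of the base `O` with its top vertex and one further vertex of type `t`. -/
def rootRow (m O t : ℕ) : ℕ :=
  addRow 1 (Nat.lor t (Nat.pow 2 m)) 0 (Nat.succ m) (Nat.succ m) (Nat.shiftLeft O 32)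

/-- The types in `P` that are compatible with a further vertex, in one of the two directions. -/
def shrink (S k m C O P : ℕ) : ℕ :=
  fold (Nat.pow 2 m) 1 (kill S k O (Nat.succ m) (dbl S (Nat.pow 2 m) (Nat.succ m) C)
    (Nat.lor P (Nat.shiftLeft P (Nat.pow 2 m))))

/-- Restrict the types to the list `l` before passing to `cont`. -/
def enter (k m O depth : ℕ) (l : List ℕ) (cont : ℕ → ℕ → ℕ → ℕ → Bool) : Bool :=
  force (len l) fun W => force (Nat.mul W (Nat.pow 2 (Nat.succ depth))) fun S =>
  force (dbl S W (Nat.succ m) (addTop S W m (cols S m l))) fun C =>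
  force (kill S k O (Nat.succ m) C (full (Nat.mul 2 W))) (cont W S C)

/-- The refutation of the type `t`, when all types belong to `P`. -/
def rootOK (S k m O need depth C P t : ℕ) : Bool :=
  force (rootRow m O t) fun O' =>
  force (shrink S k m C O' P) fun Q =>
  withBits (fun l => enter k m O' depth l fun W S C Q =>
    refute S k W depth need 1 (Nat.mul 2 W) (Nat.add 2 m) C O' Q) 100000 Q []

/-- The entry `a` of a packed list. -/
def entry (s a : ℕ) : ℕ := Nat.land 31 (Nat.shiftRight s (Nat.mul 5 a))

/-- The image of the set `t` of vertices under the packed permutation `s`. -/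
def act (m s t : ℕ) : ℕ :=
  Nat.rec 0 (fun a acc => Nat.lor acc
    (Nat.shiftLeft (Nat.land 1 (Nat.shiftRight t a)) (entry s a))) m

/-- Remove from a mask the images of `t` under the permutations `auts`. -/
def removeOrbit (m t : ℕ) (auts : List ℕ) : ℕ → ℕ :=
  List.rec (fun P => P) (fun s _ ih P => force (diff P (Nat.pow 2 (act m s t))) ih) auts

/-- Remove from a mask the orbits of all types in `ts`. -/
def stage (m : ℕ) (auts ts : List ℕ) : ℕ → ℕ :=
  List.rec (fun P => P) (fun t _ ih P => force (removeOrbit m t auts P) ih) ts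

/-- The successive refutations of the types in `ts`, each followed by the removal of its orbit. -/
def stagesOK (S k m O need depth : ℕ) (auts ts : List ℕ) (P : ℕ) : Bool :=
  force (addTop S (Nat.pow 2 m) m (dense S m)) fun C =>
  List.rec (fun _ => true)
    (fun t _ ih P => Bool.rec false (force (removeOrbit m t auts P) ih)
      (rootOK S k m O need depth C P t)) ts P

/-- The mask of the elements of `l`. -/
def mask (l : List ℕ) : ℕ := List.rec 0 (fun t _ ih => Nat.lor (Nat.pow 2 t) ih) l

/-- The bit that tells whether `a b` is an arc of the table `G`. -/
def edge (G a b : ℕ) : ℕ := Nat.land 1 (Nat.shiftRight G (Nat.add (Nat.mul 32 a) b))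

/-- The arcs of `G` that leave the vertex of type `t` are forced. -/
def orientRow (k m O need depth G i t : ℕ) (F : List ℕ) : Bool :=
  force (rootRow m O t) fun O' =>
  enter k m O' (Nat.succ depth) F fun W S C Q =>
      force (dbl S (Nat.mul 2 W) (Nat.add 2 m) C) fun C' =>
      Nat.rec true (fun j ih =>
        Bool.rec false ih
         (ifz (Nat.land 1 (Nat.shiftRight Q j)) true
         (ifz (edge G (Nat.add (Nat.succ m) i) (Nat.add (Nat.succ m) j))
           (Bool.rec (child S k (Nat.mul 2 W) (Nat.add 2 m) C C' O'
            (refute S k W depth need 2 (Nat.mul 4 W) (Nat.add 3 m) C')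
            (diff Q (Nat.pow 2 j)) j) true (Nat.beq i j))
           true))) W

/-- All the arcs of `G` between vertices with types in `F` are forced. -/
def orientOK (k m O need depth G : ℕ) (F : List ℕ) : Bool :=
  List.rec (fun _ => true) (fun t _ ih i =>
    Bool.rec false (ih (Nat.succ i)) (orientRow k m O need depth G i t F)) F 0

/-- The mask of the types below `2 ^ m` with `s` bits. -/
def layer (m : ℕ) : ℕ → ℕ :=
  Nat.rec (fun s => ifz s 1 0)
    (fun m ih s => Nat.lor (ih s) (ifz s 0 (Nat.shiftLeft (ih (Nat.sub s 1)) (Nat.pow 2 m)))) m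

/-- The refutations of the types in `ts`, when all types belong to `P`. -/
def rootsOK (S k m O need depth P : ℕ) (ts : List ℕ) : Bool :=
  force (addTop S (Nat.pow 2 m) m (dense S m)) fun C =>
  List.rec true (fun t _ ih => Bool.rec false ih (rootOK S k m O need depth C P t)) ts

theorem force_eq {α : Type} (n : ℕ) (k : ℕ → α) : force n k = k n := by cases n <;> rfl

theorem ifz_eq {α : Type} (n : ℕ) (a b : α) : ifz n a b = if n = 0 then a else b := by
  cases n <;> simp [ifz]

theorem diff_eq (x y : ℕ) : diff x y = x ^^^ (x &&& y) := rfl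

theorem testBit_diff (x y j : ℕ) : (diff x y).testBit j = (x.testBit j && !y.testBit j) := by
  rw [diff_eq, Nat.testBit_xor, Nat.testBit_and]
  cases x.testBit j <;> cases y.testBit j <;> rfl

theorem full_eq (W : ℕ) : full W = 2 ^ W - 1 := rfl

theorem testBit_full (W j : ℕ) : (full W).testBit j = decide (j < W) := by
  rw [full_eq, Nat.testBit_two_pow_sub_one]

theorem exists_lowest_bit (x : ℕ) (hx : x ≠ 0) :
    ∃ a, x.testBit a = true ∧ x ^^^ (x &&& (x - 1)) = 2 ^ a := by
  induction x using Nat.strong_induction_on with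
  | _ x ih =>
    rcases Nat.even_or_odd' x with ⟨y, rfl | rfl⟩
    · have hy : y ≠ 0 := by omega
      obtain ⟨a, ha, h⟩ := ih y (by omega) hy
      refine ⟨a + 1, by simpa [Nat.testBit_succ] using ha, ?_⟩
      rw [pow_succ, ← h]
      have e1 : (2 * y - 1) / 2 = y - 1 := by omega
      have d : (2 * y ^^^ (2 * y &&& (2 * y - 1))) / 2 = y ^^^ (y &&& (y - 1)) := by
        rw [Nat.xor_div_two, Nat.and_div_two, e1]; simp
      have m : (2 * y ^^^ (2 * y &&& (2 * y - 1))) % 2 = 0 := by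
        have h := Nat.and_mod_two_pow (a := 2 * y) (b := 2 * y - 1) (n := 1)
        rw [pow_one, Nat.mul_mod_right, Nat.zero_and] at h
        rw [Nat.xor_mod_two_eq]
        omega
      omega
    · refine ⟨0, by simp [Nat.testBit_zero], ?_⟩
      have d : (2 * y + 1 ^^^ (2 * y + 1 &&& (2 * y + 1 - 1))) / 2 = 0 := by
        rw [Nat.xor_div_two, Nat.and_div_two]
        have : (2 * y + 1) / 2 = y := by omega
        simp [this]
      have m : (2 * y + 1 ^^^ (2 * y + 1 &&& (2 * y + 1 - 1))) % 2 = 1 := by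
        have h := Nat.and_mod_two_pow (a := 2 * y + 1) (b := 2 * y + 1 - 1) (n := 1)
        rw [pow_one, Nat.add_sub_cancel, Nat.mul_mod_right, Nat.and_zero] at h
        rw [Nat.xor_mod_two_eq, Nat.add_sub_cancel]
        omega
      omega

theorem idx_two_pow : ∀ a < 32, idx (2 ^ a) = a := by decide +kernel

theorem testBit_low (x : ℕ) (hx : x ≠ 0) (h32 : ∀ a, x.testBit a = true → a < 32) :
    x.testBit (low x) = true := by
  obtain ⟨a, ha, h⟩ := exists_lowest_bit x hx
  have : low x = a := by
    change idx (x ^^^ (x &&& (x - 1))) = a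
    rw [h, idx_two_pow a (h32 a ha)]
  rwa [this]

section

variable {V : Type} {r : V → V → Prop}

/-- A transitive list, with the last vertex first. -/
def Chain (r : V → V → Prop) (l : List V) : Prop := l.Pairwise fun x y => r y x

/-- Every transitive list has fewer than `k` vertices. -/
def Free (r : V → V → Prop) (k : ℕ) : Prop := ∀ l, Chain r l → l.length < k

/-- The arcs recorded in the table `O` join the first `p` of the vertices `g`. -/
def Arcs (r : V → V → Prop) (O p : ℕ) (g : ℕ → V) : Prop :=
  ∀ a < 32, ∀ b < 32, O.testBit (32 * (a + 1) + b) = true → a < p ∧ b < p ∧ r (g a) (g b)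

/-- Index `j` of the table `C` describes the adjacencies of `z` with the first `p` of the
vertices `g`. -/
def Describes (r : V → V → Prop) (S C p : ℕ) (g : ℕ → V) (j : ℕ) (z : V) : Prop :=
  ∀ a < p, (C.testBit (S * a + j) = true → r z (g a)) ∧ (C.testBit (S * a + j) = false → r (g a) z)

/-- The chain `l` is followed by all `g a` with `a ∈ c`, and the masks `E`, `G` tell, for the
vertex `z` of index `j`, that `z` follows `l`, or can be inserted into `l`. -/
structure State (r : V → V → Prop) (p : ℕ) (g : ℕ → V) (j : ℕ) (z : V)
    (l : List V) (c E G : ℕ) : Prop where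
  chain : Chain r l
  next : ∀ a, c.testBit a = true → a < p ∧ ∀ x ∈ l, r x (g a)
  last : E.testBit j = true → ∀ x ∈ l, r x z
  mid : G.testBit j = true →
    ∃ l', Chain r l' ∧ l'.length = l.length + 1 ∧ ∀ x ∈ l', x ∈ l ∨ x = z

theorem and_pred_subset {x c : ℕ} (h : ∀ a, x.testBit a = true → c.testBit a = true) :
    ∀ a, (x.land (x.sub 1)).testBit a = true → c.testBit a = true := by
  intro a ha
  change (x &&& (x - 1)).testBit a = true at ha
  rw [Nat.testBit_and, Bool.and_eq_true] at ha
  exact h a ha.1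

section Search

variable {S C O p K j : ℕ} {g : ℕ → V} {z : V}

theorem leafLoop_sound (hp : p ≤ 32) (hC : Describes r S C p g j z) (hK : Free r K)
    {l : List V} {c E G : ℕ} (hs : State r p g j z l c E G) (hl : l.length + 2 = K) (fuel : ℕ) :
    ∀ x al, (∀ a, x.testBit a = true → c.testBit a = true) → al.testBit j = true →
      (leafLoop S C G fuel x al).testBit j = true := by
  induction fuel with
  | zero => intro x al _ h; exact h
  | succ n ih =>
    intro x al hx hal
    change (Nat.rec (motive := fun _ => ℕ) al (fun _ _ => Nat.rec (motive := fun _ => ℕ) al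
      (fun _ _ => leafLoop S C G n (x.land (x.sub 1))
        (diff al (G.land (C.shiftRight (S.mul (low x)))))) (G.land al)) x).testBit j = true
    rcases x with - | x
    · exact hal
    · rcases h : G.land al with - | y
      · exact hal
      · refine ih _ _ (and_pred_subset hx) ?_
        rw [testBit_diff, hal, Bool.true_and, Bool.not_eq_true']
        by_contra hcon
        rw [Bool.not_eq_false] at hcon
        change (G &&& (C >>> (S * low (x + 1)))).testBit j = true at hcon
        rw [Nat.testBit_and, Nat.testBit_shiftRight, Bool.and_eq_true] at hcon
        have hlow := hx _ (testBit_low (x + 1) (by omega)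
          fun a ha => (hs.next a (hx a ha)).1.trans_le hp)
        obtain ⟨hap, hr⟩ := hs.next _ hlow
        obtain ⟨l', h1, h2, h3⟩ := hs.mid hcon.1
        have := hK (g (low (x + 1)) :: l') (List.pairwise_cons.2 ⟨?_, h1⟩)
        · simp only [List.length_cons] at this
          omega
        · intro y hy
          rcases h3 y hy with hy | rfl
          · exact hr y hy
          · exact (hC _ hap).1 hcon.2

theorem testBit_rec {al b j : ℕ} (n : ℕ) (h : al.testBit j = true) (hb : b.testBit j = true) :
    (Nat.rec (motive := fun _ => ℕ) al (fun _ _ => b) n).testBit j = true := by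
  cases n
  exacts [h, hb]

/-- A function of a search state with `M ⊆ c` that never discards the index `j`. -/
def Keeps (r : V → V → Prop) (p : ℕ) (g : ℕ → V) (j : ℕ) (z : V) (M : ℕ → Prop) (l : List V)
    (f : ℕ → ℕ → ℕ → ℕ → ℕ) : Prop :=
  ∀ c E G al, State r p g j z l c E G → (∀ b, M b → c.testBit b = true) →
    al.testBit j = true → (f c E G al).testBit j = true

theorem State.step (hp : p ≤ 32) (hO : Arcs r O p g) (hC : Describes r S C p g j z)
    {l : List V} {c E G a E' G' : ℕ} (hs : State r p g j z l c E G)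
    (ha : c.testBit a = true)
    (hE : E'.testBit j = true → E.testBit j = true ∧ C.testBit (S * a + j) = false)
    (hG : G'.testBit j = true →
      (E.testBit j = true ∨ G.testBit j = true) ∧ C.testBit (S * a + j) = true) :
    State r p g j z (g a :: l) (c.land (O.shiftRight (Nat.mul 32 (Nat.succ a)))) E' G' := by
  obtain ⟨hap, hr⟩ := hs.next a ha
  refine ⟨List.pairwise_cons.2 ⟨hr, hs.chain⟩, fun b hb => ?_, fun h => ?_, fun h => ?_⟩
  · change (c &&& (O >>> (32 * (a + 1)))).testBit b = true at hb
    rw [Nat.testBit_and, Nat.testBit_shiftRight, Bool.and_eq_true] at hb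
    obtain ⟨hbp, hr'⟩ := hs.next b hb.1
    refine ⟨hbp, ?_⟩
    have := (hO a (hap.trans_le hp) b (hbp.trans_le hp) hb.2).2.2
    simpa [this] using hr'
  · obtain ⟨h1, h2⟩ := hE h
    have := (hC a hap).2 h2
    simpa [this] using hs.last h1
  · obtain ⟨h1, h2⟩ := hG h
    have hza := (hC a hap).1 h2
    rcases h1 with h1 | h1
    · refine ⟨g a :: z :: l, List.pairwise_cons.2 ⟨?_, List.pairwise_cons.2
        ⟨hs.last h1, hs.chain⟩⟩, by simp, ?_⟩
      · intro y hy
        rcases List.mem_cons.1 hy with rfl | hy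
        · exact hza
        · exact hr y hy
      · intro y hy
        simp only [List.mem_cons] at hy ⊢
        tauto
    · obtain ⟨l', h3, h4, h5⟩ := hs.mid h1
      refine ⟨g a :: l', List.pairwise_cons.2 ⟨?_, h3⟩, by simp [h4], ?_⟩
      · intro y hy
        rcases h5 y hy with hy | rfl
        · exact hr y hy
        · exact hza
      · intro y hy
        rcases List.mem_cons.1 hy with rfl | hy
        · simp
        · rcases h5 y hy with hy | rfl <;> simp [*]

theorem dfsStep_sound (hp : p ≤ 32) (hO : Arcs r O p g) (hC : Describes r S C p g j z)
    {l : List V} {c E G al a : ℕ} (hs : State r p g j z l c E G) (ha : c.testBit a = true)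
    {f : ℕ → ℕ → ℕ → ℕ → ℕ} {M : ℕ → Prop} (hf : Keeps r p g j z M (g a :: l) f)
    (hM : ∀ b, M b → c.testBit b = true ∧ O.testBit (32 * (a + 1) + b) = true) (hal : al.testBit j = true) :
    (dfsStep f O c E al a ((C.shiftRight (S.mul a)).land (al.land (E.lor G)))).testBit j
      = true := by
  refine hf _ _ _ _ (hs.step hp hO hC ha ?_ ?_) (fun b hb => ?_) hal
  · intro h
    change (diff (E &&& al) ((C >>> (S * a)) &&& (al &&& (E ||| G)))).testBit j = true at h
    simp only [testBit_diff, Nat.testBit_and, Nat.testBit_or, Nat.testBit_shiftRight] at h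
    revert h
    cases E.testBit j <;> cases C.testBit (S * a + j) <;> simp [hal]
  · intro h
    change ((C >>> (S * a)) &&& (al &&& (E ||| G))).testBit j = true at h
    simp only [Nat.testBit_and, Nat.testBit_or, Nat.testBit_shiftRight] at h
    revert h
    cases E.testBit j <;> cases C.testBit (S * a + j) <;> cases G.testBit j <;> simp
  · change (c &&& (O >>> (32 * (a + 1)))).testBit b = true
    simp [hM b hb]

theorem dfsLoop_sound (hp : p ≤ 32) (hO : Arcs r O p g) (hC : Describes r S C p g j z)
    {l : List V} {c E G : ℕ} (hs : State r p g j z l c E G)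
    {f : ℕ → ℕ → ℕ → ℕ → ℕ} {x₀ : ℕ} (h₀ : ∀ a, x₀.testBit a = true → c.testBit a = true)
    {M : ℕ → Prop} (hf : ∀ a, x₀.testBit a = true → Keeps r p g j z M (g a :: l) f)
    (hM : ∀ a, x₀.testBit a = true → ∀ b, M b →
      c.testBit b = true ∧ O.testBit (32 * (a + 1) + b) = true) (fuel : ℕ) :
    ∀ x al, (∀ a, x.testBit a = true → x₀.testBit a = true) → al.testBit j = true →
      (dfsLoop f S C O c fuel x E G al).testBit j = true := by
  induction fuel with
  | zero => intro x al _ h; exact h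
  | succ n ih =>
    intro x al hx hal
    change (Nat.rec (motive := fun _ => ℕ) al (fun _ _ => Nat.rec (motive := fun _ => ℕ) al
      (fun _ _ => dfsLoop f S C O c n (x.land (x.sub 1)) E G
        (dfsStep f O c E al (low x) ((C.shiftRight (S.mul (low x))).land (al.land (E.lor G)))))
      (al.land (E.lor G))) x).testBit j = true
    rcases x with - | x
    · exact hal
    · have hlow := hx _ (testBit_low (x + 1) (by omega)
        fun a ha => (hs.next a (h₀ a (hx a ha))).1.trans_le hp)
      have := ih _ _ (and_pred_subset hx)
        (dfsStep_sound hp hO hC hs (h₀ _ hlow) (hf _ hlow) (hM _ hlow) hal)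
      exact testBit_rec _ hal this

theorem dfs_sound (hp : p ≤ 32) (hO : Arcs r O p g) (hC : Describes r S C p g j z)
    (hK : Free r K) (k : ℕ) :
    ∀ l : List V, l.length + 2 + k = K → Keeps r p g j z (fun _ => False) l (dfs S C O k) := by
  induction k with
  | zero =>
    intro l hl c E G al hs _ hal
    change (Nat.rec (motive := fun _ => ℕ) al (fun _ _ => leafLoop S C G 32 c (diff al E))
      c).testBit j = true
    rcases c with - | c
    · exact hal
    · refine leafLoop_sound hp hC hK hs hl 32 _ _ (fun _ h => h) ?_
      rw [testBit_diff, hal, Bool.true_and, Bool.not_eq_true']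
      by_contra hcon
      rw [Bool.not_eq_false] at hcon
      obtain ⟨a, ha, -⟩ := exists_lowest_bit (c + 1) (by omega)
      obtain ⟨hap, hr⟩ := hs.next a ha
      have hl' := hs.last hcon
      cases h : C.testBit (S * a + j)
      · have := hK (z :: g a :: l) (List.pairwise_cons.2
          ⟨List.forall_mem_cons.2 ⟨(hC a hap).2 h, hl'⟩, List.pairwise_cons.2 ⟨hr, hs.chain⟩⟩)
        simp only [List.length_cons] at this
        omega
      · have := hK (g a :: z :: l) (List.pairwise_cons.2
          ⟨List.forall_mem_cons.2 ⟨(hC a hap).1 h, hr⟩, List.pairwise_cons.2 ⟨hl', hs.chain⟩⟩)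
        simp only [List.length_cons] at this
        omega
  | succ k ih =>
    intro l hl c E G al hs _ hal
    change (Nat.rec (motive := fun _ => ℕ) al (fun _ _ => dfsLoop (dfs S C O k) S C O c 32 c E G al)
      (c.land (c.sub 1))).testBit j = true
    exact testBit_rec _ hal <| dfsLoop_sound hp hO hC hs (fun _ h => h)
      (fun a _ => ih _ (by simp only [List.length_cons]; omega)) (fun _ _ _ h => h.elim)
      32 _ _ (fun _ h => h) hal

theorem dfsP_sound {q I : ℕ} (hp : p ≤ 32) (hO : Arcs r O p g) (hC : Describes r S C p g j z)
    (hK : Free r K) (hI : ∀ a, I.testBit a = true → O.testBit (32 * (a + 1) + q) = true)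
    (k : ℕ) : ∀ l : List V, l.length + 2 + k = K →
      Keeps r p g j z (fun b => b = q) l (dfsP S C O q I k) := by
  induction k with
  | zero =>
    intro l hl c E G al hs hM hal
    change (diff al (E ||| (G &&& (C >>> (S * q))))).testBit j = true
    rw [testBit_diff, hal, Bool.true_and, Bool.not_eq_true']
    by_contra hcon
    obtain ⟨hqp, hr⟩ := hs.next q (hM q rfl)
    have key : ∃ l', Chain r l' ∧ l'.length = l.length + 2 := by
      cases hE : E.testBit j
      · simp only [Nat.testBit_or, Nat.testBit_and, Nat.testBit_shiftRight, hE, Bool.false_or,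
          Bool.not_eq_false, Bool.and_eq_true] at hcon
        obtain ⟨l', h1, h2, h3⟩ := hs.mid hcon.1
        refine ⟨g q :: l', List.pairwise_cons.2 ⟨fun y hy => ?_, h1⟩, by simp [h2]⟩
        rcases h3 y hy with hy | rfl
        · exact hr y hy
        · exact (hC q hqp).1 hcon.2
      · have hl' := hs.last hE
        cases h : C.testBit (S * q + j)
        · exact ⟨z :: g q :: l, List.pairwise_cons.2 ⟨List.forall_mem_cons.2
            ⟨(hC q hqp).2 h, hl'⟩, List.pairwise_cons.2 ⟨hr, hs.chain⟩⟩, by simp⟩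
        · exact ⟨g q :: z :: l, List.pairwise_cons.2 ⟨List.forall_mem_cons.2
            ⟨(hC q hqp).1 h, hr⟩, List.pairwise_cons.2 ⟨hl', hs.chain⟩⟩, by simp⟩
    obtain ⟨l', h1, h2⟩ := key
    have := hK l' h1
    omega
  | succ k ih =>
    intro l hl c E G al hs hM hal
    change (dfsLoop (dfsP S C O q I k) S C O c 32 (c &&& I) E G
      (dfs S C O k (c.land (O.shiftRight (Nat.mul 32 (Nat.succ q)))) (diff E (C >>> (S * q)))
        ((E ||| G) &&& (C >>> (S * q))) al)).testBit j = true
    have hcI : ∀ a, (c &&& I).testBit a = true → c.testBit a = true ∧ I.testBit a = true := by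
      intro a ha
      simpa using ha
    refine dfsLoop_sound hp hO hC hs (fun a ha => (hcI a ha).1) (M := fun b => b = q)
      (fun a _ => ih _ (by simp only [List.length_cons]; omega)) ?_ 32 _ _ (fun _ h => h) ?_
    · rintro a ha b rfl
      exact ⟨hM b rfl, hI a (hcI a ha).2⟩
    · refine dfs_sound hp hO hC hK k (g q :: l) (by simp only [List.length_cons]; omega) _ _ _ _
        (hs.step hp hO hC (hM q rfl) ?_ ?_) (fun _ h => h.elim) hal
      · intro h
        simpa [testBit_diff] using h
      · intro h
        simpa using h

end Search

end

section

variable {V : Type} {r : V → V → Prop}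

theorem testBit_and_one_shiftLeft {x i b : ℕ} :
    ((1 &&& x) <<< i).testBit b = (decide (b = i) && x.testBit 0) := by
  rw [Nat.testBit_shiftLeft, Nat.testBit_and]
  by_cases h : b = i
  · subst h
    simp
  · rcases Nat.lt_or_ge b i with h' | h'
    · simp [h, Nat.not_le.2 h']
    · have : Nat.testBit 1 (b - i) = false := by
        rw [show (1 : ℕ) = 2 ^ 0 from rfl, Nat.testBit_two_pow]
        simp
        omega
      simp [h, this]

theorem and_one_shiftRight_eq_zero (x i : ℕ) :
    Nat.land 1 (Nat.shiftRight x i) = 0 ↔ x.testBit i = false := by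
  change (1 &&& (x >>> i)) = 0 ↔ _
  simp [Nat.testBit]

theorem testBit_tag {O t x : ℕ} (hx : 32 ≤ x) : (tag O t).testBit x = O.testBit x := by
  change (((O >>> 32) <<< 32) ||| (4294967295 &&& (7919 * (t + 1) + 1000003 * O))).testBit x = _
  have h : Nat.testBit 4294967295 x = false := by
    rw [show 4294967295 = 2 ^ 32 - 1 from rfl, Nat.testBit_two_pow_sub_one]
    simpa using hx
  rw [Nat.testBit_or, Nat.testBit_and, h, Nat.testBit_shiftLeft, Nat.testBit_shiftRight]
  simp [hx]

theorem Arcs.tag {O p : ℕ} {g : ℕ → V} (h : Arcs r O p g) (t : ℕ) :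
    Arcs r (tag O t) p g := by
  intro a ha b hb hab
  exact h a ha b hb (by rwa [testBit_tag (by omega)] at hab)

theorem testBit_addRow {S C t p x : ℕ} (n O : ℕ) (h : (addRow S C t p n O).testBit x = true) :
    O.testBit x = true ∨ ∃ i < n, (C.testBit (S * i + t) = true ∧ x = 32 * (p + 1) + i) ∨
      (C.testBit (S * i + t) = false ∧ x = 32 * (i + 1) + p) := by
  induction n with
  | zero => exact Or.inl h
  | succ n ih =>
    have lift : (addRow S C t p n O).testBit x = true → O.testBit x = true ∨
      ∃ i < n + 1, (C.testBit (S * i + t) = true ∧ x = 32 * (p + 1) + i) ∨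
      (C.testBit (S * i + t) = false ∧ x = 32 * (i + 1) + p) := by
      intro h
      rcases ih h with h | ⟨i, hi, h⟩
      · exact Or.inl h
      · exact Or.inr ⟨i, by omega, h⟩
    change (ifz (Nat.land 1 (Nat.shiftRight C (S * n + t)))
      (addRow S C t p n O ||| 2 ^ (32 * (n + 1) + p))
      (addRow S C t p n O ||| 2 ^ (32 * (p + 1) + n))).testBit x = true at h
    rw [ifz_eq] at h
    split_ifs at h with hC
    · rw [and_one_shiftRight_eq_zero] at hC
      rw [Nat.testBit_or, Bool.or_eq_true, Nat.testBit_two_pow, decide_eq_true_eq] at h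
      rcases h with h | h
      · exact lift h
      · exact Or.inr ⟨n, by omega, Or.inr ⟨hC, h.symm⟩⟩
    · rw [and_one_shiftRight_eq_zero, Bool.not_eq_false] at hC
      rw [Nat.testBit_or, Bool.or_eq_true, Nat.testBit_two_pow, decide_eq_true_eq] at h
      rcases h with h | h
      · exact lift h
      · exact Or.inr ⟨n, by omega, Or.inl ⟨hC, h.symm⟩⟩

theorem Arcs.addRow {S C t O p : ℕ} {g : ℕ → V} {z : V} (h : Arcs r O p g) (hp : p < 32)
    (hz : Describes r S C p g t z) :
    Arcs r (addRow S C t p p O) (p + 1) (Function.update g p z) := by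
  intro a ha b hb hab
  rcases testBit_addRow _ _ hab with hab | ⟨i, hi, ⟨h1, h2⟩ | ⟨h1, h2⟩⟩
  · obtain ⟨h1, h2, h3⟩ := h a ha b hb hab
    refine ⟨by omega, by omega, ?_⟩
    rwa [Function.update_of_ne h1.ne, Function.update_of_ne h2.ne]
  · obtain ⟨rfl, rfl⟩ : a = p ∧ b = i := by omega
    refine ⟨by omega, by omega, ?_⟩
    rw [Function.update_self, Function.update_of_ne hi.ne]
    exact (hz _ hi).1 h1
  · obtain ⟨rfl, rfl⟩ : a = i ∧ b = p := by omega
    refine ⟨by omega, by omega, ?_⟩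
    rw [Function.update_self, Function.update_of_ne hi.ne]
    exact (hz _ hi).2 h1

theorem testBit_inRow {O p a : ℕ} (n : ℕ) (h : (inRow O p n).testBit a = true) :
    O.testBit (32 * (a + 1) + p) = true := by
  induction n with
  | zero => simp [inRow] at h
  | succ n ih =>
    change (inRow O p n ||| ((1 &&& (O >>> (32 * (n + 1) + p))) <<< n)).testBit a = true at h
    rw [Nat.testBit_or, Bool.or_eq_true, testBit_and_one_shiftLeft, Bool.and_eq_true,
      decide_eq_true_eq, Nat.testBit_shiftRight] at h
    rcases h with h | ⟨rfl, h⟩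
    · exact ih h
    · simpa using h

theorem kill_sound {S C O p k j P : ℕ} {g : ℕ → V} {z : V} (hp : p < 32)
    (hO : Arcs r O (p + 1) g) (hC : Describes r S C (p + 1) g j z) (hK : Free r (k + 2))
    (hP : P.testBit j = true) : (kill S k O p C P).testBit j = true := by
  refine dfsP_sound hp hO hC hK (fun a ha => testBit_inRow _ ha) k []
    (by simp only [List.length_nil]; omega) _ _ _ _ ⟨List.Pairwise.nil, ?_, ?_, ?_⟩ ?_ hP
  · intro a ha
    rw [testBit_full, decide_eq_true_eq] at ha
    exact ⟨ha, by simp⟩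
  · simp
  · simp
  · rintro b rfl
    rw [testBit_full]
    simp

theorem mul_add_unique {S a b a' b' : ℕ} (hb : b < S) (hb' : b' < S)
    (h : S * a + b = S * a' + b') : a = a' ∧ b = b' := by
  have h1 := congrArg (· / S) h
  have h2 := congrArg (· % S) h
  simp only [Nat.mul_add_div (by omega : 0 < S), Nat.div_eq_of_lt hb, Nat.div_eq_of_lt hb',
    Nat.mul_add_mod, Nat.mod_eq_of_lt hb, Nat.mod_eq_of_lt hb'] at h1 h2
  omega

/-- The table `C` has `p` columns of width `w`, with stride `S`. -/
def Shape (S w p C : ℕ) : Prop :=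
  ∀ i, C.testBit i = true → ∃ a < p, ∃ b < w, i = S * a + b

theorem testBit_dbl (S w p C i : ℕ) : (dbl S w p C).testBit i =
    (C.testBit i || (decide (w ≤ i) && C.testBit (i - w)) ||
      (decide (S * p + w ≤ i) && decide (i - (S * p + w) < w))) := by
  change (C ||| (C <<< w) ||| (full w <<< (S * p + w))).testBit i = _
  simp only [Nat.testBit_or, Nat.testBit_shiftLeft, testBit_full]

theorem Shape.dbl {S w p C : ℕ} (h : Shape S w p C) : Shape S (2 * w) (p + 1) (dbl S w p C) := by
  intro i hi
  simp only [testBit_dbl, Bool.or_eq_true, Bool.and_eq_true, decide_eq_true_eq] at hi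
  rcases hi with (hi | ⟨h1, hi⟩) | ⟨h1, hi⟩
  · obtain ⟨a, ha, b, hb, rfl⟩ := h i hi
    exact ⟨a, by omega, b, by omega, rfl⟩
  · obtain ⟨a, ha, b, hb, h2⟩ := h _ hi
    exact ⟨a, by omega, b + w, by omega, by omega⟩
  · exact ⟨p, by omega, i - S * p, by omega, by omega⟩

theorem Shape.testBit_eq_false {S w p C a b : ℕ} (h : Shape S w p C) (hb : b < S)
    (hw : w ≤ S) (h' : p ≤ a ∨ w ≤ b) : C.testBit (S * a + b) = false := by
  by_contra hcon
  obtain ⟨a', ha', b', hb', h2⟩ := h _ (by simpa using hcon)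
  have := mul_add_unique hb (hb'.trans_le hw) h2
  omega

theorem Shape.testBit_dbl {S w p C a j : ℕ} (h : Shape S w p C) (hw : 2 * w ≤ S) (ha : a ≤ p)
    (hj : j < 2 * w) : (TTFree.dbl S w p C).testBit (S * a + j) =
      if a = p then decide (w ≤ j) else C.testBit (S * a + if j < w then j else j - w) := by
  rw [TTFree.testBit_dbl]
  have hlow : j < w → (decide (w ≤ S * a + j) && C.testBit (S * a + j - w)) = false := by
    intro hjw
    rcases a with - | a
    · simp [hjw]
    · have e : S * (a + 1) + j - w = S * a + (S + j - w) := by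
        rw [Nat.mul_succ]
        omega
      rw [e, h.testBit_eq_false (by omega) (by omega) (Or.inr (by omega)), Bool.and_false]
  have hhigh : w ≤ j → (decide (w ≤ S * a + j) && C.testBit (S * a + j - w)) =
      C.testBit (S * a + (j - w)) := by
    intro hjw
    have e : S * a + j - w = S * a + (j - w) := by omega
    simp [e, (by omega : w ≤ S * a + j)]
  split_ifs with h1 h2
  · subst h1
    rw [h.testBit_eq_false (by omega) (by omega) (Or.inl le_rfl)]
    rcases Nat.lt_or_ge j w with hjw | hjw
    · rw [hlow hjw]
      simp [hjw]
    · rw [hhigh hjw, h.testBit_eq_false (by omega) (by omega) (Or.inl le_rfl)]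
      simp [hjw]
      omega
  · have : S * a + S ≤ S * p := by
      rw [← Nat.mul_succ]
      exact Nat.mul_le_mul_left _ (by omega)
    rw [hlow h2]
    simp
    omega
  · have : S * a + S ≤ S * p := by
      rw [← Nat.mul_succ]
      exact Nat.mul_le_mul_left _ (by omega)
    rw [hhigh (by omega), h.testBit_eq_false (by omega) (by omega) (Or.inr (by omega))]
    simp
    omega

theorem Describes.dbl {S w p C j : ℕ} {g : ℕ → V} {y z : V} (h : Shape S w p C)
    (hw : 2 * w ≤ S) (hj : j < w) (hz : Describes r S C p g j z) (hyz : r z y ∨ r y z) :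
    ∃ j', (j' = j ∨ j' = j + w) ∧
      Describes r S (dbl S w p C) (p + 1) (Function.update g p y) j' z := by
  have old : ∀ j', (j' = j ∨ j' = j + w) → ∀ a < p,
      (TTFree.dbl S w p C).testBit (S * a + j') = C.testBit (S * a + j) := by
    intro j' hj' a ha
    rw [h.testBit_dbl hw ha.le (by omega), if_neg ha.ne]
    congr 2
    split_ifs <;> omega
  have new : ∀ j', (j' = j ∨ j' = j + w) →
      (TTFree.dbl S w p C).testBit (S * p + j') = decide (w ≤ j') := by
    intro j' hj'
    rw [h.testBit_dbl hw le_rfl (by omega), if_pos rfl]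
  have main : ∀ j', (j' = j ∨ j' = j + w) → (w ≤ j' → r z y) → (j' < w → r y z) →
      Describes r S (TTFree.dbl S w p C) (p + 1) (Function.update g p y) j' z := by
    intro j' hj' h1 h2 a ha
    rcases Nat.lt_succ_iff_lt_or_eq.1 ha with ha | rfl
    · rw [old j' hj' a ha, Function.update_of_ne ha.ne]
      exact hz a ha
    · rw [new j' hj', Function.update_self]
      simpa using ⟨h1, h2⟩
  rcases hyz with hyz | hyz
  · exact ⟨j + w, Or.inr rfl, main _ (Or.inr rfl) (fun _ => hyz) (fun h => by omega)⟩
  · exact ⟨j, Or.inl rfl, main _ (Or.inl rfl) (fun h => by omega) (fun _ => hyz)⟩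

end

section

variable {V : Type} {r : V → V → Prop}

theorem exists_testBit_fold {W j : ℕ} (d P : ℕ) (h : P.testBit j = true) :
    ∃ j', j' % W = j % W ∧ (fold W d P).testBit j' = true := by
  induction d generalizing P j with
  | zero => exact ⟨j, rfl, h⟩
  | succ d ih =>
    change ∃ j', _ ∧ (force ((P >>> (W * 2 ^ d)) ||| (P &&& full (W * 2 ^ d)))
      (fold W d)).testBit j' = true
    rw [force_eq]
    rcases Nat.lt_or_ge j (W * 2 ^ d) with hj | hj
    · exact ih _ (by simp [testBit_full, h, hj])
    · obtain ⟨i, rfl⟩ := Nat.exists_eq_add_of_le hj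
      obtain ⟨j', h1, h2⟩ := ih (j := i) ((P >>> (W * 2 ^ d)) ||| (P &&& full (W * 2 ^ d)))
        (by simp [Nat.testBit_shiftRight, h])
      exact ⟨j', by rw [h1, Nat.add_mod, Nat.mul_mod_right, Nat.zero_add, Nat.mod_mod], h2⟩

theorem atLeast_eq_true {n u : ℕ} {T : Finset ℕ} (hT : n ≤ T.card)
    (h : ∀ x ∈ T, u.testBit x = true) : atLeast n u = true := by
  induction n generalizing u T with
  | zero => rfl
  | succ n ih =>
    change ifz u false (force (u &&& (u - 1)) (atLeast n)) = true
    obtain ⟨x, hx⟩ : T.Nonempty := Finset.card_pos.1 (by omega)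
    have hu : u ≠ 0 := by
      rintro rfl
      simpa using h x hx
    rw [ifz_eq, if_neg hu, force_eq]
    obtain ⟨a, -, ha⟩ := exists_lowest_bit u hu
    refine ih (T := T.erase a) (by have := Finset.pred_card_le_card_erase (s := T) (a := a); omega)
      fun x hx => ?_
    rw [Finset.mem_erase] at hx
    have h2 := congrArg (Nat.testBit · x) ha
    simpa [Nat.testBit_two_pow_of_ne (Ne.symm hx.1), h x hx.2] using h2

/-- Each vertex `Z ρ` with `ρ ∈ R` is described by an index `j ∈ P` of residue `ρ`. -/
def Cover (r : V → V → Prop) (S C p : ℕ) (g : ℕ → V) (W w : ℕ) (Z : ℕ → V) (R : Finset ℕ)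
    (P : ℕ) : Prop :=
  ∀ ρ ∈ R, ∃ j < w, P.testBit j = true ∧ j % W = ρ ∧ Describes r S C p g j (Z ρ)

section Refute

variable {S k W w p C O P t : ℕ} {g Z : ℕ → V} {R : Finset ℕ}

theorem Cover.atLeast (h : Cover r S C p g W w Z R P) {need : ℕ} (hR : need ≤ R.card) (d : ℕ) :
    atLeast need (fold W d P) = true := by
  have : ∀ ρ, ∃ j', ρ ∈ R → j' % W = ρ ∧ (fold W d P).testBit j' = true := by
    intro ρ
    by_cases hρ : ρ ∈ R
    · obtain ⟨j, -, h1, h2, -⟩ := h ρ hρ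
      obtain ⟨j', h3, h4⟩ := exists_testBit_fold d P h1
      exact ⟨j', fun _ => ⟨h3.trans h2, h4⟩⟩
    · exact ⟨0, fun h => absurd h hρ⟩
  choose f hf using this
  refine atLeast_eq_true (T := R.image f) ?_ ?_
  · rwa [Finset.card_image_of_injOn]
    intro a ha b hb hab
    rw [← (hf a ha).1, ← (hf b hb).1, hab]
  · simp only [Finset.mem_image]
    rintro _ ⟨ρ, hρ, rfl⟩
    exact (hf ρ hρ).2

theorem Cover.kill_dbl (h : Cover r S C p g W w Z R P) {O' : ℕ} {y : V} (hC : Shape S w p C)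
    (hw : 2 * w ≤ S) (hW : W ∣ w) (hp : p < 32) (hK : Free r (k + 2))
    (hO : Arcs r O' (p + 1) (Function.update g p y)) (hZ : ∀ ρ ∈ R, r (Z ρ) y ∨ r y (Z ρ)) :
    Cover r S (dbl S w p C) (p + 1) (Function.update g p y) W (2 * w) Z R
      (kill S k O' p (dbl S w p C) (P.lor (P.shiftLeft w))) := by
  intro ρ hρ
  obtain ⟨j, hj, hPj, hjρ, hz⟩ := h ρ hρ
  obtain ⟨j', hj', hz'⟩ := hz.dbl hC hw hj (hZ ρ hρ)
  refine ⟨j', by omega, kill_sound hp hO hz' hK ?_, ?_, hz'⟩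
  · change (P ||| (P <<< w)).testBit j' = true
    rcases hj' with rfl | rfl <;> simp [hPj]
  · obtain ⟨c, rfl⟩ := hW
    rcases hj' with rfl | rfl <;> simp [hjρ]

theorem child_sound {y : V} {ref : ℕ → ℕ → Bool} (hC : Shape S w p C) (hw : 2 * w ≤ S)
    (hW : W ∣ w) (hp : p < 32) (hK : Free r (k + 2)) (hO : Arcs r O p g)
    (hy : Describes r S C p g t y) (hZ : ∀ ρ ∈ R, r (Z ρ) y ∨ r y (Z ρ))
    (h : Cover r S C p g W w Z R P)
    (href : ∀ O' P', Arcs r O' (p + 1) (Function.update g p y) →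
      Cover r S (dbl S w p C) (p + 1) (Function.update g p y) W (2 * w) Z R P' →
      ref O' P' = false) :
    child S k w p C (dbl S w p C) O ref P t = false := by
  have hO' := (hO.tag t).addRow hp hy
  change force (addRow S C t p p (tag O t)) (fun O' => force (kill S k O' p (dbl S w p C)
    (P.lor (P.shiftLeft w))) (ref O')) = false
  rw [force_eq, force_eq]
  exact href _ _ hO' (h.kill_dbl hC hw hW hp hK hO' hZ)

theorem refuteLoop_sound {need d : ℕ} {ref : ℕ → ℕ → Bool} (hC : Shape S w p C)
    (hw : 2 * w ≤ S) (hW : W ∣ w) (hp : p < 32) (hK : Free r (k + 2)) (hO : Arcs r O p g)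
    (htot : ∀ x y : V, x ≠ y → r x y ∨ r y x) (hZ : Set.InjOn Z R)
    (href : ∀ R' ⊆ R, need.sub 1 ≤ R'.card → ∀ y O' P',
      Arcs r O' (p + 1) (Function.update g p y) →
      Cover r S (dbl S w p C) (p + 1) (Function.update g p y) W (2 * w) Z R' P' →
      ref O' P' = false) (hR : need ≤ R.card) (fuel : ℕ) : ∀ P, Cover r S C p g W w Z R P →
    refuteLoop S k W need d w p C (dbl S w p C) O ref fuel P = false := by
  induction fuel with
  | zero => intro P _; rfl
  | succ n ih =>
    intro P h
    change Bool.rec (motive := fun _ => Bool) true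
        (force (find P 13 0) fun t => force (P ^^^ (2 ^ t)) fun P' =>
          Bool.rec false (refuteLoop S k W need d w p C (dbl S w p C) O ref n P')
            (child S k w p C (dbl S w p C) O ref P' t))
        (force (fold W d P) (TTFree.atLeast need)) = false
    rw [force_eq (fold W d P), h.atLeast hR d]
    change (force (find P 13 0) fun t => force (P ^^^ (2 ^ t)) fun P' =>
          Bool.rec false (refuteLoop S k W need d w p C (dbl S w p C) O ref n P')
            (child S k w p C (dbl S w p C) O ref P' t)) = false
    rw [force_eq, force_eq]
    generalize find P 13 0 = t
    have keep : ∀ j, j ≠ t → P.testBit j = true → (P ^^^ 2 ^ t).testBit j = true := by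
      intro j hj hP
      rw [Nat.testBit_xor, hP, Nat.testBit_two_pow_of_ne hj.symm]
      rfl
    rcases hch : child S k w p C (dbl S w p C) O ref (P ^^^ 2 ^ t) t with - | -
    · rfl
    · refine ih _ fun ρ hρ => ?_
      obtain ⟨j, hj, hPj, hjρ, hz⟩ := h ρ hρ
      refine ⟨j, hj, keep j ?_ hPj, hjρ, hz⟩
      rintro rfl
      rw [← Bool.not_eq_false] at hch
      refine hch (child_sound (R := R.erase ρ) (Z := Z) (y := Z ρ) hC hw hW hp hK hO hz ?_ ?_ ?_)
      · intro ρ' hρ'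
        rw [Finset.mem_erase] at hρ'
        exact htot _ _ fun e => hρ'.1 (hZ hρ'.2 hρ e)
      · intro ρ' hρ'
        rw [Finset.mem_erase] at hρ'
        obtain ⟨j', hj', hPj', hjρ', hz'⟩ := h ρ' hρ'.2
        refine ⟨j', hj', keep j' ?_ hPj', hjρ', hz'⟩
        rintro rfl
        exact hρ'.1 (hjρ'.symm.trans hjρ)
      · exact href _ (Finset.erase_subset _ _)
          (by rw [Finset.card_erase_of_mem hρ]; exact Nat.sub_le_sub_right hR 1) _

theorem refute_sound (hW : W ∣ w) (hK : Free r (k + 2))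
    (htot : ∀ x y : V, x ≠ y → r x y ∨ r y x) (hZ : Set.InjOn Z R) (depth : ℕ)
    (hC : Shape S w p C) (hw : w * 2 ^ depth ≤ S)
    (hp : p + depth ≤ 32) (hO : Arcs r O p g) {need d : ℕ} (hR : need ≤ R.card)
    (h : Cover r S C p g W w Z R P) :
    refute S k W depth need d w p C O P = false := by
  induction depth generalizing w p C O g need d R P with
  | zero => rfl
  | succ n ih =>
    change force (dbl S w p C) (fun C' => refuteLoop S k W need d w p C C' O
        (refute S k W n (need.sub 1) (d.succ) (Nat.mul 2 w) p.succ C') 100000) P = false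
    rw [force_eq]
    have hw' : 2 * w * 2 ^ n ≤ S := by
      rw [pow_succ] at hw
      linarith
    refine refuteLoop_sound hC ?_ hW (by omega) hK hO htot hZ ?_ hR _ _ h
    · exact (Nat.le_mul_of_pos_right _ (by positivity)).trans hw'
    · intro R' hR' hcard y O' P' hO' h'
      exact ih (hW.mul_left 2) (hZ.mono hR') hC.dbl hw' (by omega) hO' hcard h'

end Refute

end

section

variable {V : Type} {r : V → V → Prop}

theorem testBit_spread {S t m x : ℕ} : (spread S t m).testBit x = true ↔
    ∃ a < m, x = S * a ∧ t.testBit a = true := by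
  induction m with
  | zero => simp [spread]
  | succ m ih =>
    change (spread S t m ||| ((1 &&& (t >>> m)) <<< (S * m))).testBit x = true ↔ _
    rw [Nat.testBit_or, Bool.or_eq_true, ih, testBit_and_one_shiftLeft, Bool.and_eq_true,
      decide_eq_true_eq, Nat.testBit_shiftRight, Nat.exists_lt_succ_right]
    rfl

theorem len_eq (l : List ℕ) : len l = l.length := by
  induction l with
  | nil => rfl
  | cons a l ih =>
    change len l + 1 = _
    rw [ih, List.length_cons]

theorem testBit_cols_cons {S m t x : ℕ} {l : List ℕ} : (cols S m (t :: l)).testBit x = true ↔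
    (∃ a < m, x = S * a ∧ t.testBit a = true) ∨ 1 ≤ x ∧ (cols S m l).testBit (x - 1) = true := by
  change (spread S t m ||| (cols S m l <<< 1)).testBit x = true ↔ _
  rw [Nat.testBit_or, Bool.or_eq_true, testBit_spread, Nat.testBit_shiftLeft, Bool.and_eq_true,
    decide_eq_true_eq]

theorem shape_cols {S m : ℕ} (l : List ℕ) : Shape S l.length m (cols S m l) := by
  induction l with
  | nil => intro i hi; simp [cols] at hi
  | cons t l ih =>
    intro i hi
    rcases testBit_cols_cons.1 hi with ⟨a, ha, rfl, -⟩ | ⟨h1, h2⟩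
    · exact ⟨a, ha, 0, by simp, rfl⟩
    · obtain ⟨a, ha, b, hb, h⟩ := ih _ h2
      exact ⟨a, ha, b + 1, by simpa using hb, by omega⟩

theorem testBit_cols {S m a i : ℕ} {l : List ℕ} (hS : l.length ≤ S) (ha : a < m)
    (hi : i < l.length) : (cols S m l).testBit (S * a + i) = l[i].testBit a := by
  induction l generalizing i with
  | nil => simp at hi
  | cons t l ih =>
    rw [List.length_cons] at hS hi
    rw [Bool.eq_iff_iff, testBit_cols_cons]
    rcases i with - | i
    · constructor
      · rintro (⟨a', -, h1, h2⟩ | ⟨h1, h2⟩)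
        · rwa [(mul_add_unique (S := S) (b' := 0) (by omega) (by omega) h1).1]
        · rcases a with - | a
          · omega
          · rw [Nat.mul_succ, show S * a + S + 0 - 1 = S * a + (S - 1) by omega,
              (shape_cols l).testBit_eq_false (by omega) (by omega) (by omega)] at h2
            simp at h2
      · intro h
        exact Or.inl ⟨a, ha, rfl, h⟩
    · rw [List.getElem_cons_succ, ← ih (by omega) (by omega)]
      constructor
      · rintro (⟨a', -, h1, h2⟩ | ⟨h1, h2⟩)
        · have := (mul_add_unique (S := S) (b' := 0) (by omega) (by omega) h1).2
          omega
        · exact h2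
      · intro h
        exact Or.inr ⟨by omega, h⟩

theorem Shape.addTop {S W m C : ℕ} (h : Shape S W m C) : Shape S W (m + 1) (addTop S W m C) := by
  intro i hi
  change (C ||| (full W <<< (S * m))).testBit i = true at hi
  simp only [Nat.testBit_or, Nat.testBit_shiftLeft, testBit_full, Bool.or_eq_true,
    Bool.and_eq_true, decide_eq_true_eq] at hi
  rcases hi with hi | hi
  · obtain ⟨a, ha, b, hb, rfl⟩ := h i hi
    exact ⟨a, by omega, b, hb, rfl⟩
  · exact ⟨m, by omega, i - S * m, hi.2, by omega⟩

theorem Shape.testBit_addTop {S W m C a j : ℕ} (h : Shape S W m C) (hW : W ≤ S) (ha : a ≤ m)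
    (hj : j < W) : (TTFree.addTop S W m C).testBit (S * a + j) =
      if a = m then true else C.testBit (S * a + j) := by
  change (C ||| (full W <<< (S * m))).testBit _ = _
  rw [Nat.testBit_or, Nat.testBit_shiftLeft, testBit_full]
  split_ifs with h1
  · subst h1
    simp [hj]
  · have : S * a + S ≤ S * m := by
      rw [← Nat.mul_succ]
      exact Nat.mul_le_mul_left _ (by omega)
    simp
    omega

theorem shape_dense {S m : ℕ} : Shape S (2 ^ m) m (dense S m) := by
  induction m with
  | zero => intro i hi; simp [dense] at hi
  | succ m ih =>
    rw [pow_succ']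
    exact ih.dbl

theorem testBit_dense {S m a j : ℕ} (hS : 2 ^ m ≤ S) (ha : a < m) (hj : j < 2 ^ m) :
    (dense S m).testBit (S * a + j) = j.testBit a := by
  induction m generalizing j with
  | zero => omega
  | succ m ih =>
    change (dbl S (2 ^ m) m (dense S m)).testBit _ = _
    rw [pow_succ'] at hS hj
    rw [shape_dense.testBit_dbl hS (by omega) hj]
    have hj' : ¬ j < 2 ^ m → ∃ i < 2 ^ m, j = 2 ^ m + i := fun h => ⟨j - 2 ^ m, by omega, by omega⟩
    split_ifs with h1 h2
    · subst h1
      rcases Nat.lt_or_ge j (2 ^ a) with h | h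
      · rw [Nat.testBit_lt_two_pow h]
        simpa using h
      · obtain ⟨i, hi, rfl⟩ := hj' (by omega)
        rw [Nat.testBit_two_pow_add_eq, Nat.testBit_lt_two_pow hi]
        simp
    · exact ih (by omega) (by omega) h2
    · obtain ⟨i, hi, rfl⟩ := hj' h2
      rw [Nat.add_sub_cancel_left, ih (by omega) (by omega) hi,
        Nat.testBit_two_pow_add_gt (by omega)]

/-- The vertex `z` dominates `g m`, and the binary digits of `t` tell which of the vertices
`g a` with `a < m` it dominates. -/
def HasType (r : V → V → Prop) (m : ℕ) (g : ℕ → V) (t : ℕ) (z : V) : Prop :=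
  t < 2 ^ m ∧ r z (g m) ∧
    ∀ a < m, (t.testBit a = true → r z (g a)) ∧ (t.testBit a = false → r (g a) z)

section Root

variable {S k m O t : ℕ} {g : ℕ → V} {y z : V}

theorem HasType.describes_dense (h : HasType r m g t z) (hS : 2 ^ m ≤ S) :
    Describes r S (addTop S (2 ^ m) m (dense S m)) (m + 1) g t z := by
  intro a ha
  rw [shape_dense.testBit_addTop hS (by omega) h.1]
  split_ifs with h1
  · subst h1
    simpa using h.2.1
  · rw [testBit_dense hS (by omega) h.1]
    exact h.2.2 a (by omega)

theorem describes_cols {l : List ℕ} {i : ℕ} (hi : i < l.length) (h : HasType r m g l[i] z)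
    (hS : l.length ≤ S) :
    Describes r S (addTop S l.length m (cols S m l)) (m + 1) g i z := by
  intro a ha
  rw [(shape_cols l).testBit_addTop hS (by omega) hi]
  split_ifs with h1
  · subst h1
    simpa using h.2.1
  · rw [testBit_cols hS (by omega) hi]
    exact h.2.2 a (by omega)

theorem testBit_start (h : HasType r m g t z) (hS : 2 ^ m ≤ S) (hm : m < 32)
    (hK : Free r (k + 2)) (hO : Arcs r (O <<< 32) (m + 1) g) :
    (start S k m O).testBit t = true := by
  change (force (addTop S (2 ^ m) m (dense S m)) fun C =>
    dfs S C (O <<< 32) k (full (m + 1)) (full (2 ^ m)) 0 (full (2 ^ m))).testBit t = true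
  rw [force_eq]
  refine dfs_sound (by omega) hO (h.describes_dense hS) hK k []
    (by simp only [List.length_nil]; omega) _ _ _ _ ⟨List.Pairwise.nil, ?_, ?_, ?_⟩
    (fun _ h => h.elim) ?_
  · intro a ha
    rw [testBit_full, decide_eq_true_eq] at ha
    exact ⟨ha, by simp⟩
  · simp
  · simp
  · rw [testBit_full, decide_eq_true_eq]
    exact h.1

theorem HasType.arcs_rootRow (h : HasType r m g t y) (hm : m + 1 < 32)
    (hO : Arcs r (O <<< 32) (m + 1) g) :
    Arcs r (rootRow m O t) (m + 2) (Function.update g (m + 1) y) := by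
  refine hO.addRow hm ?_
  intro a ha
  change ((t ||| 2 ^ m).testBit _ = true → _) ∧ ((t ||| 2 ^ m).testBit _ = false → _)
  rw [Nat.one_mul, Nat.add_zero, Nat.testBit_or, Nat.testBit_two_pow]
  rcases Nat.lt_succ_iff_lt_or_eq.1 ha with ha | rfl
  · simpa [ha.ne'] using h.2.2 a ha
  · simpa using h.2.1

theorem testBit_shrink {O' P : ℕ} (h : HasType r m g t z) (hP : P.testBit t = true)
    (hzy : r z y ∨ r y z) (hS : 2 * 2 ^ m ≤ S) (hm : m + 1 < 32) (hK : Free r (k + 2))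
    (hO : Arcs r O' (m + 2) (Function.update g (m + 1) y)) :
    (shrink S k m (addTop S (2 ^ m) m (dense S m)) O' P).testBit t = true := by
  obtain ⟨j, hj, hz⟩ := (h.describes_dense (by omega)).dbl shape_dense.addTop hS h.1 hzy
  change (force (_ >>> (2 ^ m * 2 ^ 0) ||| _ &&& full (2 ^ m * 2 ^ 0)) (fun P => P)).testBit t = true
  rw [force_eq, Nat.testBit_or, Nat.testBit_shiftRight, Nat.testBit_and, testBit_full, pow_zero,
    mul_one, Nat.add_comm]
  have := kill_sound (P := P ||| P <<< 2 ^ m) hm hO hz hK (by rcases hj with rfl | rfl <;> simp [hP])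
  rcases hj with rfl | rfl
  · rw [Bool.or_eq_true, Bool.and_eq_true, decide_eq_true_eq]
    exact Or.inr ⟨this, h.1⟩
  · rw [Bool.or_eq_true]
    exact Or.inl this

theorem withBits_eq_false {cont : List ℕ → Bool} (fuel : ℕ) : ∀ P l,
    (∀ l', (∀ j, P.testBit j = true ∨ j ∈ l → j ∈ l') → cont l' = false) →
    withBits cont fuel P l = false := by
  induction fuel with
  | zero => intro P l _; rfl
  | succ n ih =>
    intro P l h
    change (ifz P (cont (List.reverse l)) (force (find P 13 0) fun t => force (P ^^^ (2 ^ t))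
      fun P' => withBits cont n P' (t :: l))) = false
    rw [ifz_eq, force_eq, force_eq]
    generalize find P 13 0 = t
    split_ifs with h0
    · subst h0
      exact h _ (by simp)
    · refine ih _ _ fun l' hl' => h l' fun j hj => ?_
      by_cases hjt : j = t
      · exact hl' j (Or.inr (by simp [hjt]))
      · refine hl' j ?_
        rcases hj with hj | hj
        · left
          rw [Nat.testBit_xor, hj, Nat.testBit_two_pow_of_ne (Ne.symm hjt)]
          rfl
        · exact Or.inr (by simp [hj])

theorem enter_eq_false {depth O' : ℕ} {l : List ℕ} {cont : ℕ → ℕ → ℕ → ℕ → Bool} {Z : ℕ → V}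
    {R : Finset ℕ} (hm : m + 1 < 32) (hK : Free r (k + 2))
    (hO : Arcs r O' (m + 2) (Function.update g (m + 1) y))
    (hR : ∀ ρ ∈ R, (r (Z ρ) y ∨ r y (Z ρ)) ∧ ∃ h : ρ < l.length, HasType r m g l[ρ] (Z ρ))
    (h : ∀ S C Q, S = l.length * 2 ^ (depth + 1) → Shape S (2 * l.length) (m + 2) C →
      Cover r S C (m + 2) (Function.update g (m + 1) y) l.length (2 * l.length) Z R Q →
      (∀ j < 2 * l.length, C.testBit (S * (m + 1) + j) = decide (l.length ≤ j)) →
      cont l.length S C Q = false) :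
    enter k m O' depth l cont = false := by
  change (force (len l) fun W => force (Nat.mul W (2 ^ (depth + 1))) fun S =>
    force (dbl S W (m + 1) (addTop S W m (cols S m l))) fun C =>
    force (kill S k O' (m + 1) C (full (Nat.mul 2 W))) (cont W S C)) = false
  rw [force_eq, force_eq, force_eq, force_eq, len_eq]
  have hS : 2 * l.length ≤ l.length * 2 ^ (depth + 1) := by
    rw [pow_succ]
    nlinarith [Nat.one_le_two_pow (n := depth), Nat.zero_le l.length]
  refine h _ _ _ rfl (shape_cols l).addTop.dbl (fun ρ hρ => ?_) fun j hj => ?_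
  swap
  · have := (shape_cols (m := m) l).addTop.testBit_dbl hS le_rfl hj
    rwa [if_pos rfl] at this
  obtain ⟨h1, hi, h2⟩ := hR ρ hρ
  obtain ⟨j, hj, hz⟩ := (describes_cols hi h2 (S := l.length * 2 ^ (depth + 1)) (by omega)).dbl
    (shape_cols l).addTop hS hi h1
  refine ⟨j, by omega, kill_sound hm hO hz hK ?_, ?_, hz⟩
  · rw [testBit_full, decide_eq_true_eq]
    change j < 2 * l.length
    omega
  · rcases hj with rfl | rfl
    · exact Nat.mod_eq_of_lt hi
    · rw [Nat.add_mod_right, Nat.mod_eq_of_lt hi]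

theorem rootOK_eq_false {P need depth : ℕ} (hS : 2 * 2 ^ m ≤ S)
    (hm : m + 2 + depth ≤ 32) (hK : Free r (k + 2)) (htot : ∀ x y : V, x ≠ y → r x y ∨ r y x)
    (hO : Arcs r (O <<< 32) (m + 1) g) (hy : HasType r m g t y) {B : Finset V}
    {τ : V → ℕ} (hB : ∀ z ∈ B, z ≠ y ∧ HasType r m g (τ z) z ∧ P.testBit (τ z) = true)
    (hτ : Set.InjOn τ B) (hneed : need ≤ B.card) :
    rootOK S k m O need depth (addTop S (2 ^ m) m (dense S m)) P t = false := by
  change (force (rootRow m O t) fun O' =>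
    force (shrink S k m (addTop S (2 ^ m) m (dense S m)) O' P) fun Q =>
    withBits (fun l => enter k m O' depth l fun W S C Q =>
    refute S k W depth need 1 (Nat.mul 2 W) (Nat.add 2 m) C O' Q) 100000 Q []) = false
  rw [force_eq, force_eq]
  have hm' : m + 1 < 32 := by omega
  have hO' := hy.arcs_rootRow hm' hO
  refine withBits_eq_false _ _ _ fun l hl => ?_
  have hl' : ∀ z ∈ B, τ z ∈ l := fun z hz =>
    hl _ (Or.inl (testBit_shrink (hB z hz).2.1 (hB z hz).2.2 (htot _ _ (hB z hz).1) hS hm' hK hO'))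
  set f : V → ℕ := fun z => l.idxOf (τ z) with hf
  have hfinj : Set.InjOn f B := by
    intro z hz z' hz' e
    refine hτ hz hz' ?_
    exact (List.idxOf_inj (hl' z hz)).1 e
  have : Nonempty V := ⟨y⟩
  set Z : ℕ → V := Function.invFunOn f B
  have hZ : ∀ ρ ∈ B.image f, Z ρ ∈ B ∧ f (Z ρ) = ρ := fun ρ hρ =>
    Function.invFunOn_pos (by simpa using hρ)
  refine enter_eq_false (Z := Z) (R := B.image f) hm' hK hO' ?_ ?_
  · intro ρ hρ
    obtain ⟨h1, h2⟩ := hZ ρ hρ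
    refine ⟨htot _ _ (hB _ h1).1, ?_⟩
    have h3 : ρ < l.length := by
      rw [← h2]
      exact List.idxOf_lt_length_iff.2 (hl' _ h1)
    refine ⟨h3, ?_⟩
    have : ∀ i (hi : i < l.length), i = l.idxOf (τ (Z ρ)) → l[i] = τ (Z ρ) := by
      rintro _ hi rfl
      exact List.getElem_idxOf hi
    rw [this ρ h3 h2.symm]
    exact (hB _ h1).2.1
  · rintro S C Q rfl hC hQ -
    change refute _ k _ depth need 1 (2 * l.length) (2 + m) C _ Q = false
    rw [Nat.add_comm 2 m]
    refine refute_sound (Dvd.intro_left 2 rfl) hK htot ?_ depth hC ?_ hm hO' ?_ hQ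
    · intro a ha b hb e
      rw [← (hZ a ha).2, ← (hZ b hb).2, e]
    · change 2 * l.length * 2 ^ depth ≤ _
      rw [pow_succ]
      linarith
    · rwa [Finset.card_image_of_injOn hfinj]

end Root

end

section

variable {V : Type} {r : V → V → Prop}

theorem tot_of_isTournament (h : IsTournament r) (x y : V) (hxy : x ≠ y) : r x y ∨ r y x :=
  (h.2 x y hxy).imp And.left And.left

theorem asymm_of_isTournament (h : IsTournament r) {x y : V} (hxy : r x y) : ¬ r y x := by
  intro hyx
  rcases eq_or_ne x y with rfl | hne
  · exact h.1 _ hxy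
  · rcases h.2 x y hne with h' | h'
    exacts [h'.2 hyx, h'.2 hxy]

/-- The vertices `g a` with `a < m` are the out-neighbours of `v = g m`, and the table `O` records
arcs between these vertices. -/
structure IsBase (r : V → V → Prop) (m O : ℕ) (v : V) (g : ℕ → V) : Prop where
  arcs : Arcs r (O <<< 32) (m + 1) g
  top : g m = v
  out : ∀ a < m, r v (g a)
  surj : ∀ x, r v x → ∃ a < m, g a = x

/-- The types of the vertices in `B` belong to `P`, whatever the choice of the base. -/
def Within (r : V → V → Prop) (m O : ℕ) (v : V) (B : Finset V) (P : ℕ) : Prop :=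
  ∀ g, IsBase r m O v g → ∀ z ∈ B, ∀ t, HasType r m g t z → P.testBit t = true

/-- Vertices of `B` are in-neighbours of `v` distinguished by the out-neighbours of `v`. -/
def Separated (r : V → V → Prop) (v : V) (B : Finset V) : Prop :=
  (∀ z ∈ B, r z v) ∧ ∀ z ∈ B, ∀ w ∈ B, (∀ x, r v x → (r z x ↔ r w x)) → z = w

/-- The packed list `s` is an automorphism of the table `O`. -/
def IsAut (m O s : ℕ) : Prop :=
  (∀ a < m, entry s a < m) ∧ (∀ b < m, ∃ a < m, entry s a = b) ∧
    ∀ a < m, ∀ b < m, O.testBit (32 * a + b) = true →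
      O.testBit (32 * entry s a + entry s b) = true

instance (m O s : ℕ) : Decidable (IsAut m O s) := by
  unfold IsAut
  infer_instance

theorem testBit_act {m s t x : ℕ} : (act m s t).testBit x = true ↔
    ∃ a < m, entry s a = x ∧ t.testBit a = true := by
  induction m with
  | zero => simp [act]
  | succ m ih =>
    change (act m s t ||| ((1 &&& (t >>> m)) <<< (entry s m))).testBit x = true ↔ _
    rw [Nat.testBit_or, Bool.or_eq_true, ih, testBit_and_one_shiftLeft, Bool.and_eq_true,
      decide_eq_true_eq, Nat.testBit_shiftRight, Nat.exists_lt_succ_right, eq_comm (a := x)]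
    rfl

theorem IsAut.injOn {m O s : ℕ} (h : IsAut m O s) {a b : ℕ} (ha : a < m) (hb : b < m)
    (hab : entry s a = entry s b) : a = b := by
  have := Finset.injOn_of_surjOn_of_card_le (s := Finset.range m) (t := Finset.range m) (entry s)
    (fun a ha => by simpa using h.1 a (by simpa using ha))
    (fun b hb => by simpa using h.2.1 b (by simpa using hb)) le_rfl
  exact this (by simpa using ha) (by simpa using hb) hab

theorem IsAut.testBit_act {m O s a : ℕ} (h : IsAut m O s) (t : ℕ) (ha : a < m) :
    (act m s t).testBit (entry s a) = t.testBit a := by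
  rw [Bool.eq_iff_iff, TTFree.testBit_act]
  constructor
  · rintro ⟨a', ha', h1, h2⟩
    rwa [← h.injOn ha' ha h1]
  · intro h'
    exact ⟨a, ha, rfl, h'⟩

theorem IsBase.comp {m O s : ℕ} {v : V} {g : ℕ → V} (hT : IsTournament r) (hm : m < 32)
    (hg : IsBase r m O v g) (hs : IsAut m O s) :
    IsBase r m O v fun a => if a < m then g (entry s a) else g a := by
  refine ⟨?_, by simpa using hg.top, ?_, ?_⟩
  · intro a ha b hb hab
    obtain ⟨h1, h2, h3⟩ := hg.arcs a ha b hb hab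
    refine ⟨h1, h2, ?_⟩
    rcases Nat.lt_succ_iff_lt_or_eq.1 h1 with h1 | rfl <;>
    rcases Nat.lt_succ_iff_lt_or_eq.1 h2 with h2 | rfl
    · simp only [h1, h2, if_true]
      refine (hg.arcs _ ((hs.1 a h1).trans hm) _ ((hs.1 b h2).trans hm) ?_).2.2
      rw [Nat.testBit_shiftLeft] at hab ⊢
      simp only [Bool.and_eq_true, decide_eq_true_eq] at hab ⊢
      refine ⟨by omega, ?_⟩
      convert hs.2.2 a h1 b h2 ?_ using 2
      · omega
      · convert hab.2 using 2
        omega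
    · rw [hg.top] at h3
      exact absurd h3 (asymm_of_isTournament hT (hg.out a h1))
    · simp only [h2, lt_irrefl, if_true, if_false, hg.top]
      exact hg.out _ (hs.1 b h2)
    · exact absurd h3 (hT.1 _)
  · intro a ha
    simp only [ha, if_true]
    exact hg.out _ (hs.1 a ha)
  · intro x hx
    obtain ⟨b, hb, rfl⟩ := hg.surj x hx
    obtain ⟨a, ha, rfl⟩ := hs.2.1 b hb
    exact ⟨a, ha, by simp [ha]⟩

theorem HasType.comp {m O s t : ℕ} {g : ℕ → V} {z : V} (hs : IsAut m O s)
    (h : HasType r m g (act m s t) z) (ht : t < 2 ^ m) :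
    HasType r m (fun a => if a < m then g (entry s a) else g a) t z := by
  refine ⟨ht, by simpa using h.2.1, fun a ha => ?_⟩
  simp only [ha, if_true]
  rw [← hs.testBit_act t ha]
  exact h.2.2 _ (hs.1 a ha)

theorem IsBase.exists_hasType {m O : ℕ} {v z : V} {g : ℕ → V} (hT : IsTournament r)
    (hg : IsBase r m O v g) (hz : r z v) : ∃ t, HasType r m g t z := by
  classical
  refine ⟨Nat.ofBits fun i : Fin m => decide (r z (g i)), Nat.ofBits_lt_two_pow _,
    by rwa [hg.top], fun a ha => ?_⟩
  rw [Nat.testBit_ofBits_lt _ _ ha]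
  simp only [decide_eq_true_eq, decide_eq_false_iff_not, imp_self, true_and]
  intro h
  refine (tot_of_isTournament hT _ _ ?_).resolve_left h
  rintro rfl
  exact asymm_of_isTournament hT hz (hg.out a ha)

theorem HasType.rel_iff {m t a : ℕ} {g : ℕ → V} {z : V} (hT : IsTournament r)
    (h : HasType r m g t z) (ha : a < m) : r z (g a) ↔ t.testBit a = true := by
  refine ⟨fun h1 => ?_, (h.2.2 a ha).1⟩
  by_contra h2
  exact asymm_of_isTournament hT h1 ((h.2.2 a ha).2 (by simpa using h2))

theorem Separated.eq {m O t : ℕ} {v z z' : V} {g : ℕ → V} {B : Finset V} (hT : IsTournament r)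
    (hB : Separated r v B) (hg : IsBase r m O v g) (hz : z ∈ B) (hz' : z' ∈ B)
    (h : HasType r m g t z) (h' : HasType r m g t z') : z = z' := by
  refine hB.2 z hz z' hz' fun x hx => ?_
  obtain ⟨a, ha, rfl⟩ := hg.surj x hx
  rw [h.rel_iff hT ha, h'.rel_iff hT ha]

theorem Separated.mono {v : V} {B B' : Finset V} (h : Separated r v B) (hB : B' ⊆ B) :
    Separated r v B' :=
  ⟨fun z hz => h.1 z (hB hz), fun z hz z' hz' => h.2 z (hB hz) z' (hB hz')⟩

section Stage

variable {S k m O need depth P t : ℕ} {v y : V} {g : ℕ → V} {B : Finset V}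

theorem rootOK_false (hT : IsTournament r) (hK : Free r (k + 2)) (hS : 2 * 2 ^ m ≤ S)
    (hm : m + 2 + depth ≤ 32) (hB : Separated r v B) (hP : Within r m O v B P)
    (hg : IsBase r m O v g) (hy : HasType r m g t y) (hyB : y ∉ B) (hneed : need ≤ B.card) :
    rootOK S k m O need depth (addTop S (2 ^ m) m (dense S m)) P t = false := by
  have : ∀ z, ∃ t, z ∈ B → HasType r m g t z := by
    intro z
    by_cases hz : z ∈ B
    · exact (hg.exists_hasType hT (hB.1 z hz)).imp fun t h _ => h
    · exact ⟨0, fun h => absurd h hz⟩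
  choose τ hτ using this
  refine rootOK_eq_false (B := B) (τ := τ) hS hm hK (tot_of_isTournament hT) hg.arcs hy ?_ ?_ hneed
  · intro z hz
    exact ⟨fun h => hyB (h ▸ hz), hτ z hz, hP g hg z hz _ (hτ z hz)⟩
  · intro z hz z' hz' h
    exact hB.eq hT hg hz hz' (hτ z hz) (h ▸ hτ z' hz')

theorem within_start (hK : Free r (k + 2)) (hS : 2 ^ m ≤ S) (hm : m < 32) :
    Within r m O v B (start S k m O) :=
  fun _ hg _ _ _ ht => testBit_start ht hS hm hK hg.arcs

theorem testBit_removeOrbit {j : ℕ} (auts : List ℕ) (P : ℕ) (h : P.testBit j = true) :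
    (removeOrbit m t auts P).testBit j = true ∨ ∃ s ∈ auts, j = act m s t := by
  induction auts generalizing P with
  | nil => exact Or.inl h
  | cons s l ih =>
    change (force (diff P (2 ^ act m s t)) (removeOrbit m t l)).testBit j = true ∨ _
    rw [force_eq]
    by_cases hj : j = act m s t
    · exact Or.inr ⟨s, by simp, hj⟩
    · rcases ih (diff P (2 ^ act m s t))
        (by rw [testBit_diff, h, Nat.testBit_two_pow_of_ne (Ne.symm hj)]; rfl) with h' | ⟨s', h1, h2⟩
      · exact Or.inl h'
      · exact Or.inr ⟨s', by simp [h1], h2⟩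

theorem rec_false_eq_and (b x : Bool) :
    Bool.rec (motive := fun _ => Bool) false x b = (b && x) := by cases b <;> rfl

theorem stagesOK_cons (auts ts : List ℕ) : stagesOK S k m O need depth auts (t :: ts) P =
    (rootOK S k m O need depth (addTop S (2 ^ m) m (dense S m)) P t &&
      stagesOK S k m O need depth auts ts (removeOrbit m t auts P)) := by
  unfold stagesOK
  rw [force_eq, force_eq]
  dsimp only
  rw [rec_false_eq_and, force_eq]
  rfl

theorem rootsOK_cons (ts : List ℕ) : rootsOK S k m O need depth P (t :: ts) =
    (rootOK S k m O need depth (addTop S (2 ^ m) m (dense S m)) P t &&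
      rootsOK S k m O need depth P ts) := by
  unfold rootsOK
  rw [force_eq, force_eq]
  dsimp only
  rw [rec_false_eq_and]
  rfl

theorem Within.stage {auts ts : List ℕ} (hT : IsTournament r) (hK : Free r (k + 2))
    (hS : 2 * 2 ^ m ≤ S) (hm : m + 2 + depth ≤ 32) (hB : Separated r v B)
    (hauts : ∀ s ∈ auts, IsAut m O s) (hts : ∀ t ∈ ts, t < 2 ^ m) (hneed : need + 1 ≤ B.card)
    (hP : Within r m O v B P) (h : stagesOK S k m O need depth auts ts P = true) :
    Within r m O v B (stage m auts ts P) := by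
  classical
  induction ts generalizing P with
  | nil => exact hP
  | cons t ts ih =>
    change Within r m O v B (force (removeOrbit m t auts P) (TTFree.stage m auts ts))
    rw [force_eq]
    rw [stagesOK_cons, Bool.and_eq_true] at h
    refine ih (fun t' ht' => hts t' (by simp [ht'])) ?_ h.2
    intro g hg z hz j hj
    refine (testBit_removeOrbit auts P (hP g hg z hz j hj)).resolve_right ?_
    rintro ⟨s, hs, rfl⟩
    have hs' := hauts s hs
    have h1 := rootOK_false (B := B.erase z) (need := need) hT hK hS hm
      (hB.mono (Finset.erase_subset _ _))
      (fun g hg z' hz' => hP g hg z' (Finset.mem_of_mem_erase hz')) (hg.comp hT (by omega) hs')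
      (hj.comp hs' (hts t (by simp))) (by simp)
      (by rw [Finset.card_erase_of_mem hz]; omega)
    exact absurd h.1 (by rw [h1]; simp)

theorem rootsOK_false {ts : List ℕ} (hT : IsTournament r) (hK : Free r (k + 2))
    (hS : 2 * 2 ^ m ≤ S) (hm : m + 2 + depth ≤ 32) (hB : Separated r v B)
    (hP : Within r m O v B P) (hg : IsBase r m O v g) (hy : HasType r m g t y) (hyB : y ∉ B)
    (hneed : need ≤ B.card) (ht : t ∈ ts) : rootsOK S k m O need depth P ts = false := by
  induction ts with
  | nil => simp at ht
  | cons t' ts ih =>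
    rw [rootsOK_cons]
    rcases List.mem_cons.1 ht with rfl | ht
    · rw [rootOK_false hT hK hS hm hB hP hg hy hyB hneed, Bool.false_and]
    · rw [ih ht, Bool.and_false]

theorem testBit_mask {l : List ℕ} {j : ℕ} : (mask l).testBit j = true ↔ j ∈ l := by
  induction l with
  | nil => simp [mask]
  | cons t l ih =>
    change (2 ^ t ||| mask l).testBit j = true ↔ _
    rw [Nat.testBit_or, Bool.or_eq_true, ih, Nat.testBit_two_pow, decide_eq_true_eq,
      List.mem_cons, eq_comm]

theorem testBit_layer {s : ℕ} (ht : t < 2 ^ m)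
    (h : ((Finset.range m).filter fun a => t.testBit a = true).card = s) :
    (layer m s).testBit t = true := by
  induction m generalizing s t with
  | zero =>
    obtain rfl : t = 0 := by simpa using ht
    subst h
    rfl
  | succ m ih =>
    change (layer m s ||| ifz s 0 ((layer m (s - 1)) <<< (2 ^ m))).testBit t = true
    rw [Nat.testBit_or, Bool.or_eq_true, ifz_eq]
    rw [Finset.range_add_one, Finset.filter_insert] at h
    rcases Nat.lt_or_ge t (2 ^ m) with h1 | h1
    · rw [if_neg (by simp [Nat.testBit_lt_two_pow h1])] at h
      exact Or.inl (ih h1 h)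
    · obtain ⟨u, rfl⟩ := Nat.exists_eq_add_of_le h1
      have hu : u < 2 ^ m := by rw [pow_succ] at ht; omega
      rw [if_pos (by simp [Nat.testBit_two_pow_add_eq, Nat.testBit_lt_two_pow hu]),
        Finset.card_insert_of_notMem (by simp)] at h
      right
      rw [if_neg (by omega), Nat.testBit_shiftLeft, Nat.add_sub_cancel_left,
        ih hu (s := s - 1) ?_]
      · simp
      · rw [← h, Nat.add_sub_cancel]
        congr 1
        refine Finset.filter_congr fun a ha => ?_
        rw [Nat.testBit_two_pow_add_gt (by simpa using ha)]

end Stage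

end

section

open Classical in
/-- The out-neighbours of `v`. -/
noncomputable def outN {V : Type} [Fintype V] (r : V → V → Prop) (v : V) : Finset V :=
  Finset.univ.filter fun x => r v x

open Classical in
/-- The in-neighbours of `v`. -/
noncomputable def inN {V : Type} [Fintype V] (r : V → V → Prop) (v : V) : Finset V :=
  Finset.univ.filter fun x => r x v

/-- A tournament without a transitive list of `k` vertices has at most `n` vertices. -/
def RamseyBound (k n : ℕ) : Prop :=
  ∀ (V : Type) [Fintype V] (r : V → V → Prop), IsTournament r → Free r k → Fintype.card V ≤ n

/-- The tournament `r` embeds into the table `G` with `n` vertices. -/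
def Emb {V : Type} (r : V → V → Prop) (G n : ℕ) : Prop :=
  ∃ φ : V → ℕ, Function.Injective φ ∧ (∀ x, φ x < n) ∧
    ∀ x y, r x y → G.testBit (32 * φ x + φ y) = true

section Sub

variable {V : Type} {r : V → V → Prop}

theorem isTournament_sub (h : IsTournament r) (p : V → Prop) :
    IsTournament fun x y : {x // p x} => r x y :=
  ⟨fun v => h.1 v, fun u v huv => h.2 u v fun e => huv (Subtype.ext e)⟩

theorem chain_map_val {p : V → Prop} {l : List {x // p x}} (h : Chain (fun x y : {x // p x} => r x y) l) :
    Chain r (l.map Subtype.val) :=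
  List.pairwise_map.2 h

theorem free_out {k : ℕ} (h : Free r (k + 1)) (v : V) :
    Free (fun x y : {x // r v x} => r x y) k := by
  intro l hl
  have := h (l.map Subtype.val ++ [v]) (List.pairwise_append.2 ⟨chain_map_val hl, by simp, ?_⟩)
  · simpa using this
  · simp only [List.mem_map, List.mem_singleton]
    rintro _ ⟨x, -, rfl⟩ _ rfl
    exact x.2

theorem free_in {k : ℕ} (h : Free r (k + 1)) (v : V) :
    Free (fun x y : {x // r x v} => r x y) k := by
  intro l hl
  have := h (v :: l.map Subtype.val) (List.pairwise_cons.2 ⟨?_, chain_map_val hl⟩)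
  · simpa using this
  · simp only [List.mem_map]
    rintro _ ⟨x, -, rfl⟩
    exact x.2

theorem RamseyBound.finset {k n : ℕ} (h : RamseyBound k n) (hT : IsTournament r) {A : Finset V}
    (hA : ∀ l, Chain r l → (∀ x ∈ l, x ∈ A) → l.length < k) : A.card ≤ n := by
  rw [← Fintype.card_coe]
  refine h _ _ (isTournament_sub hT (· ∈ A)) fun l hl => ?_
  simpa using hA _ (chain_map_val hl) (by simp +contextual)

variable [Fintype V]

theorem mem_outN {v x : V} : x ∈ outN r v ↔ r v x := by simp [outN]

theorem mem_inN {v x : V} : x ∈ inN r v ↔ r x v := by simp [inN]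

open Classical in
theorem card_outN (v : V) : (outN r v).card = Fintype.card {x // r v x} :=
  (Fintype.card_subtype _).symm

open Classical in
theorem card_inN (v : V) : (inN r v).card = Fintype.card {x // r x v} :=
  (Fintype.card_subtype _).symm

theorem RamseyBound.card_outN_le {k n : ℕ} (h : RamseyBound k n) (hT : IsTournament r)
    (hK : Free r (k + 1)) (v : V) : (outN r v).card ≤ n := by
  classical
  rw [card_outN]
  exact h _ _ (isTournament_sub hT _) (free_out hK v)

theorem card_outN_add_card_inN (hT : IsTournament r) (v : V) :
    (outN r v).card + (inN r v).card + 1 = Fintype.card V := by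
  classical
  have h1 : Disjoint (outN r v) (inN r v) := by
    rw [Finset.disjoint_left]
    intro x hx hx'
    exact asymm_of_isTournament hT (mem_outN.1 hx) (mem_inN.1 hx')
  have h2 : v ∉ outN r v ∪ inN r v := by
    simp [mem_outN, mem_inN, hT.1 v]
  rw [← Finset.card_union_of_disjoint h1, ← Finset.card_insert_of_notMem h2, ← Finset.card_univ]
  congr 1
  ext x
  simp only [Finset.mem_insert, Finset.mem_union, mem_outN, mem_inN, Finset.mem_univ, iff_true]
  by_cases h : x = v
  · exact Or.inl h
  · exact Or.inr (tot_of_isTournament hT _ _ (Ne.symm h))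

theorem sum_card_outN (r : V → V → Prop) :
    ∑ v, (outN r v).card = ∑ v, (inN r v).card := by
  classical
  exact Finset.sum_card_bipartiteAbove_eq_sum_card_bipartiteBelow r

theorem exists_card_le_outN [Nonempty V] (hT : IsTournament r) :
    ∃ v, Fintype.card V ≤ 2 * (outN r v).card + 1 := by
  by_contra! h
  have : ∑ v, (outN r v).card < ∑ v, (inN r v).card := by
    refine Finset.sum_lt_sum_of_nonempty Finset.univ_nonempty fun v _ => ?_
    have := h v
    have := card_outN_add_card_inN hT v
    omega
  exact this.ne (sum_card_outN r)

theorem RamseyBound.step {k n : ℕ} (h : RamseyBound k n) : RamseyBound (k + 1) (2 * n + 1) := by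
  intro V _ r hT hK
  rcases isEmpty_or_nonempty V with hV | hV
  · simp
  · obtain ⟨v, hv⟩ := exists_card_le_outN hT
    have := h.card_outN_le hT hK v
    omega

theorem ramseyBound_one : RamseyBound 1 0 := by
  intro V _ r _ hK
  rw [Nat.le_zero, Fintype.card_eq_zero_iff]
  exact ⟨fun x => by simpa using hK [x] (List.pairwise_singleton _ _)⟩

theorem separated_inN {k a b : ℕ} {v : V} (hT : IsTournament r) (hK : Free r (k + 3))
    (ha : RamseyBound k a) (hb : RamseyBound (k + 1) b) (h : a + b < (outN r v).card) :
    Separated r v (inN r v) := by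
  classical
  have key : ∀ z z', r z v → r z' v → r z z' → ¬ ∀ x, r v x → (r z x ↔ r z' x) := by
    intro z z' hz hz' hzz' hx
    have h1 : ((outN r v).filter fun x => r z x).card ≤ a := by
      refine ha.finset hT fun l hl hlA => ?_
      simp only [Finset.mem_filter, mem_outN] at hlA
      have := hK (l ++ [v, z', z]) (List.pairwise_append.2 ⟨hl, by simp [*], ?_⟩)
      · simpa using this
      · intro x hxl y hy
        obtain ⟨h1, h2⟩ := hlA x hxl
        simp only [List.mem_cons, List.not_mem_nil, or_false] at hy
        rcases hy with rfl | rfl | rfl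
        exacts [h1, (hx x h1).1 h2, h2]
    have h2 : ((outN r v).filter fun x => ¬ r z x).card ≤ b := by
      refine hb.finset hT fun l hl hlA => ?_
      simp only [Finset.mem_filter, mem_outN] at hlA
      have hlz : ∀ x ∈ l, r x z ∧ r x z' := by
        intro x hxl
        obtain ⟨h1, h2⟩ := hlA x hxl
        refine ⟨(tot_of_isTournament hT _ _ ?_).resolve_left h2,
          (tot_of_isTournament hT _ _ ?_).resolve_left ((hx x h1).not.1 h2)⟩
        · rintro rfl
          exact asymm_of_isTournament hT h1 hz
        · rintro rfl
          exact asymm_of_isTournament hT h1 hz'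
      have := hK (z' :: z :: l) (List.pairwise_cons.2 ⟨List.forall_mem_cons.2
        ⟨hzz', fun x hx => (hlz x hx).2⟩, List.pairwise_cons.2 ⟨fun x hx => (hlz x hx).1, hl⟩⟩)
      simp only [List.length_cons] at this
      omega
    have := Finset.card_filter_add_card_filter_not (s := outN r v) (fun x => r z x)
    omega
  refine ⟨fun z hz => mem_inN.1 hz, fun z hz z' hz' hx => ?_⟩
  rw [mem_inN] at hz hz'
  by_contra hne
  rcases tot_of_isTournament hT z z' hne with h1 | h1
  · exact key z z' hz hz' h1 hx
  · exact key z' z hz' hz h1 fun x hvx => (hx x hvx).symm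

end Sub

section Embedding

variable {V : Type} {r : V → V → Prop}

theorem Emb.comp {G n s : ℕ} (hs : IsAut n G s) {φ : V → ℕ} (h1 : Function.Injective φ)
    (h2 : ∀ x, φ x < n) (h3 : ∀ x y, r x y → G.testBit (32 * φ x + φ y) = true) :
    Function.Injective (entry s ∘ φ) ∧ (∀ x, (entry s ∘ φ) x < n) ∧
      ∀ x y, r x y → G.testBit (32 * (entry s ∘ φ) x + (entry s ∘ φ) y) = true :=
  ⟨fun x y h => h1 (hs.injOn (h2 x) (h2 y) h), fun x => hs.1 _ (h2 x),
    fun x y h => hs.2.2 _ (h2 x) _ (h2 y) (h3 x y h)⟩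

theorem exists_notMem_range [Fintype V] {n : ℕ} (φ : V → ℕ) (h : Fintype.card V < n) :
    ∃ u < n, ∀ x, φ x ≠ u := by
  classical
  by_contra! hcon
  have : Finset.range n ⊆ Finset.univ.image φ := by
    intro u hu
    obtain ⟨x, hx⟩ := hcon u (Finset.mem_range.1 hu)
    exact Finset.mem_image.2 ⟨x, Finset.mem_univ _, hx⟩
  have h1 := Finset.card_le_card this
  have h2 := Finset.card_image_le (s := Finset.univ) (f := φ)
  rw [Finset.card_range] at h1
  rw [Finset.card_univ] at h2
  omega

/-- An embedding that misses a vertex can be moved, by an automorphism, so that it misses the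
last vertex. -/
theorem Emb.pred [Fintype V] {G n : ℕ} {auts : List ℕ} (hr : Emb r G (n + 1))
    (hV : Fintype.card V ≤ n) (hauts : ∀ s ∈ auts, IsAut (n + 1) G s)
    (htrans : ∀ u < n + 1, ∃ s ∈ auts, entry s u = n) : Emb r G n := by
  obtain ⟨φ, h1, h2, h3⟩ := hr
  obtain ⟨u, hu, hφ⟩ := exists_notMem_range φ (Nat.lt_succ_of_le hV)
  obtain ⟨s, hs, hsu⟩ := htrans u hu
  obtain ⟨h4, h5, h6⟩ := Emb.comp (hauts s hs) h1 h2 h3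
  refine ⟨_, h4, fun x => lt_of_le_of_ne (Nat.le_of_lt_succ (h5 x)) fun h => hφ x ?_, h6⟩
  exact (hauts s hs).injOn (h2 x) hu (h.trans hsu.symm)

/-- The table `O` consists of the table `G` on `m` vertices and of a vertex `m` that dominates
them. -/
def BaseTable (m O G : ℕ) : Prop :=
  ∀ a < 32, ∀ b < 32, O.testBit (32 * a + b) = true →
    (a = m ∧ b < m) ∨ (a < m ∧ b < m ∧ a ≠ b ∧ G.testBit (32 * b + a) = false)

instance (m O G : ℕ) : Decidable (BaseTable m O G) := by
  unfold BaseTable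
  infer_instance

theorem exists_isBase [Fintype V] {m O G : ℕ} {v : V} (hT : IsTournament r)
    (hA : (outN r v).card = m) (hE : Emb (fun x y : {x // r v x} => r x y) G m)
    (hO : BaseTable m O G) : ∃ g, IsBase r m O v g := by
  classical
  obtain ⟨φ, h1, h2, h3⟩ := hE
  rw [card_outN] at hA
  have hbij : Function.Bijective fun x => (⟨φ x, h2 x⟩ : Fin m) := by
    refine (Fintype.bijective_iff_injective_and_card _).2 ⟨fun x y h => h1 (Fin.mk.inj h), ?_⟩
    rw [hA, Fintype.card_fin]
  have hex : ∀ a, ∃ x : V, (a < m → ∃ h : r v x, φ ⟨x, h⟩ = a) ∧ (¬ a < m → x = v) := by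
    intro a
    by_cases ha : a < m
    · obtain ⟨x, hx⟩ := hbij.2 ⟨a, ha⟩
      exact ⟨x.1, fun _ => ⟨x.2, congrArg Fin.val hx⟩, fun h => absurd ha h⟩
    · exact ⟨v, fun h => absurd h ha, fun _ => rfl⟩
  choose g hg hg' using hex
  refine ⟨g, ?_, hg' m (lt_irrefl m), fun a ha => (hg a ha).1, ?_⟩
  · intro a ha b hb hab
    rw [Nat.testBit_shiftLeft, Bool.and_eq_true,
      show 32 * (a + 1) + b - 32 = 32 * a + b by omega] at hab
    rcases hO a ha b hb hab.2 with ⟨rfl, h⟩ | ⟨h, h', hne, hG⟩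
    · refine ⟨by omega, by omega, ?_⟩
      rw [hg' a (lt_irrefl a)]
      exact (hg b h).1
    · refine ⟨by omega, by omega, ?_⟩
      obtain ⟨ha1, ha2⟩ := hg a h
      obtain ⟨hb1, hb2⟩ := hg b h'
      refine (tot_of_isTournament hT _ _ ?_).resolve_right fun hcon => ?_
      · intro e
        apply hne
        rw [← ha2, ← hb2]
        congr 1
        exact Subtype.ext e
      · have := h3 ⟨_, hb1⟩ ⟨_, ha1⟩ hcon
        rw [ha2, hb2, hG] at this
        cases this
  · intro x hx
    refine ⟨φ ⟨x, hx⟩, h2 _, ?_⟩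
    obtain ⟨h4, h5⟩ := hg _ (h2 ⟨x, hx⟩)
    exact congrArg Subtype.val (h1 h5)

end Embedding

end

section

theorem natRec_eq_false {f : ℕ → Bool} {n j : ℕ} (hj : j < n) (h : f j = false) :
    Nat.rec (motive := fun _ => Bool) true (fun j ih => Bool.rec false ih (f j)) n = false := by
  induction n with
  | zero => omega
  | succ n ih =>
    change Bool.rec (motive := fun _ => Bool) false (Nat.rec _ _ n) (f n) = false
    rw [rec_false_eq_and]
    rcases Nat.lt_succ_iff_lt_or_eq.1 hj with hj | rfl
    · rw [ih hj, Bool.and_false]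
    · rw [h, Bool.false_and]

section Orient

variable {V : Type} {r : V → V → Prop} {S k m O need depth G : ℕ} {F : List ℕ} {v : V}
  {g : ℕ → V} {B : Finset V} {τ : V → ℕ}

theorem orientRow_eq_false (hT : IsTournament r) (hK : Free r (k + 2)) (hm : m + 3 + depth ≤ 32)
    (hg : IsBase r m O v g) (hB : ∀ z ∈ B, HasType r m g (τ z) z ∧ τ z ∈ F)
    (hτ : Set.InjOn τ B) (hneed : need + 2 ≤ B.card) {y z : V} (hy : y ∈ B) (hz : z ∈ B)
    (hyz : r y z)
    (hG : edge G (m + 1 + F.idxOf (τ y)) (m + 1 + F.idxOf (τ z)) = 0) :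
    orientRow k m O need depth G (F.idxOf (τ y)) (τ y) F = false := by
  classical
  have htot := tot_of_isTournament hT
  set f : V → ℕ := fun z => F.idxOf (τ z) with hf
  have hfinj : Set.InjOn f B := fun z hz z' hz' e =>
    hτ hz hz' ((List.idxOf_inj (hB z hz).2).1 e)
  have hne : y ≠ z := fun e => hT.1 _ (e ▸ hyz)
  have hflt : ∀ z ∈ B, f z < F.length := fun z hz => List.idxOf_lt_length_iff.2 (hB z hz).2
  have : Nonempty V := ⟨y⟩
  set Z : ℕ → V := Function.invFunOn f B
  have hZ : ∀ x ∈ B, Z (f x) = x := fun x hx => hfinj.leftInvOn_invFunOn hx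
  have hm' : m + 1 < 32 := by omega
  have hO' := (hB y hy).1.arcs_rootRow hm' hg.arcs
  change force (rootRow m O (τ y)) _ = false
  rw [force_eq]
  refine enter_eq_false (Z := Z) (R := (B.erase y).image f) hm' hK hO' ?_ ?_
  · simp only [Finset.mem_image, Finset.mem_erase]
    rintro _ ⟨x, ⟨hxy, hx⟩, rfl⟩
    rw [hZ x hx]
    refine ⟨htot _ _ hxy, hflt x hx, ?_⟩
    rw [List.getElem_idxOf]
    exact (hB x hx).1
  · intro S C Q hS hC hQ hrow
    have hzR : f z ∈ (B.erase y).image f :=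
      Finset.mem_image_of_mem _ (Finset.mem_erase.2 ⟨hne.symm, hz⟩)
    obtain ⟨j, hj, hQj, hjz, hdesc⟩ := hQ _ hzR
    rw [hZ z hz] at hdesc
    have hjF : j < F.length := by
      have h1 := hrow j hj
      by_contra h2
      rw [decide_eq_true (by omega)] at h1
      have h3 := (hdesc (m + 1) (by omega)).1 h1
      rw [Function.update_self] at h3
      exact asymm_of_isTournament hT hyz h3
    rw [Nat.mod_eq_of_lt hjF] at hjz
    subst hjz
    have hmul : Nat.mul 4 F.length = 2 * (2 * F.length) := by
      change 4 * F.length = _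
      omega
    have hS2 : 2 * (2 * F.length) * 2 ^ depth ≤ S := by
      rw [hS, pow_succ, pow_succ]
      exact le_of_eq (by ring)
    rw [force_eq]
    refine natRec_eq_false hjF ?_
    have hG' : edge G (m.succ.add (F.idxOf (τ y))) (m.succ.add (f z)) = 0 := hG
    rw [ifz_eq, if_neg, ifz_eq, if_pos hG']
    · have hb : Nat.beq (f y) (f z) = false := by
        rw [← Bool.not_eq_true, Nat.beq_eq]
        exact fun e => hne (hfinj hy hz e)
      change Bool.rec (motive := fun _ => Bool) _ true (Nat.beq (f y) (f z)) = false
      rw [hb]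
      have hmem : ∀ ρ ∈ ((B.erase y).image f).erase (f z), ∃ x ∈ B, x ≠ z ∧ f x = ρ := by
        simp only [Finset.mem_image, Finset.mem_erase]
        rintro _ ⟨h1, x, ⟨-, hx⟩, rfl⟩
        exact ⟨x, hx, fun e => h1 (e ▸ rfl), rfl⟩
      rw [show Nat.add 2 m = m + 2 from Nat.add_comm 2 m]
      change child S k (2 * F.length) (m + 2) C (dbl S (2 * F.length) (m + 2) C) _ _ _ _ = false
      refine child_sound (y := z) (Z := Z) (W := F.length) (R := ((B.erase y).image f).erase (f z)) hC
        ?_ (Dvd.intro_left 2 rfl) (by omega) hK hO' hdesc ?_ ?_ ?_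
      · exact (Nat.le_mul_of_pos_right _ (by positivity)).trans hS2
      · intro ρ hρ
        obtain ⟨x, hx, hxz, rfl⟩ := hmem ρ hρ
        rw [hZ x hx]
        exact htot _ _ hxz
      · intro ρ hρ
        obtain ⟨hρ1, hρ2⟩ := Finset.mem_erase.1 hρ
        obtain ⟨j', hj', h1, h2, h3⟩ := hQ ρ hρ2
        refine ⟨j', hj', ?_, h2, h3⟩
        change (diff Q (2 ^ f z)).testBit j' = true
        rw [testBit_diff, h1, Nat.testBit_two_pow_of_ne]
        · rfl
        · rintro rfl
          exact hρ1 (by rw [← h2]; exact Nat.mod_eq_of_lt hjF)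
      · intro O'' P' hO'' hP'
        rw [hmul, show Nat.add 3 m = m + 2 + 1 from Nat.add_comm 3 m]
        refine refute_sound (Z := Z) (R := ((B.erase y).image f).erase (f z))
          ((Nat.dvd_mul_left _ 2).mul_left 2) hK htot ?_ depth hC.dbl hS2 (by omega)
          hO'' ?_ hP'
        · intro a ha b hb e
          obtain ⟨x, hx, -, rfl⟩ := hmem a ha
          obtain ⟨x', hx', -, rfl⟩ := hmem b hb
          rw [hZ x hx, hZ x' hx'] at e
          rw [e]
        · rw [Finset.card_erase_of_mem hzR, Finset.card_image_of_injOn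
            (hfinj.mono (by simp)), Finset.card_erase_of_mem hy]
          omega
    · intro h0
      have := congrArg (Nat.testBit · 0) h0
      change (1 &&& (Q >>> f z)).testBit 0 = Nat.testBit 0 0 at this
      simp [hQj] at this

theorem orientOK_eq_false {i : ℕ} (hi : i < F.length)
    (h : orientRow k m O need depth G i F[i] F = false) : orientOK k m O need depth G F = false := by
  suffices ∀ (l : List ℕ) (a j : ℕ) (hj : j < l.length),
      orientRow k m O need depth G (a + j) l[j] F = false →
      List.rec (motive := fun _ => ℕ → Bool) (fun _ => true) (fun t _ ih i =>
        Bool.rec false (ih (Nat.succ i)) (orientRow k m O need depth G i t F)) l a = false from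
    this F 0 i hi (by rwa [Nat.zero_add])
  intro l
  induction l with
  | nil => intro a j hj; simp at hj
  | cons t l ih =>
    intro a j hj hrow
    dsimp only
    rw [rec_false_eq_and]
    rcases j with - | j
    · simp only [Nat.add_zero, List.getElem_cons_zero] at hrow
      rw [hrow, Bool.false_and]
    · rw [ih (a + 1) j (by simpa using hj) (by rw [← hrow]; congr 1; omega), Bool.and_false]

end Orient

end

/-- The table `G` extends the base described by `O` by vertices `m + 1 + i` of types `F[i]`. -/
def OrientTable (m O G : ℕ) (F : List ℕ) : Prop :=
  (∀ a < m, G.testBit (32 * m + a) = true ∧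
    ∀ b < m, a ≠ b → G.testBit (32 * a + b) = true ∨ O.testBit (32 * b + a) = true) ∧
  ∀ i (h : i < F.length), G.testBit (32 * (m + 1 + i) + m) = true ∧
    ∀ a < m, G.testBit (if F[i].testBit a = true then 32 * (m + 1 + i) + a
      else 32 * a + (m + 1 + i)) = true

instance (m O G : ℕ) (F : List ℕ) : Decidable (OrientTable m O G F) := by
  unfold OrientTable
  infer_instance

/-- The members of `start S k m O` with `s` elements. -/
def startLayer (S k m O s : ℕ) : ℕ := Nat.land (layer m s) (start S k m O)

theorem testBit_startLayer {S k m O s t : ℕ} : (startLayer S k m O s).testBit t =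
    ((layer m s).testBit t && (start S k m O).testBit t) :=
  Nat.testBit_and _ _ _

theorem edge_ne_zero {G a b : ℕ} (h : edge G a b ≠ 0) : G.testBit (32 * a + b) = true := by
  change 1 &&& (G >>> (32 * a + b)) ≠ 0 at h
  simpa [Nat.testBit] using h

theorem emb_of_base {V : Type} [Fintype V] {r : V → V → Prop} {k m O need depth G : ℕ}
    {F : List ℕ} {v : V} {g : ℕ → V} (hT : IsTournament r) (hK : Free r (k + 2))
    (hm : m + 3 + depth ≤ 32) (hg : IsBase r m O v g) (hsep : Separated r v (inN r v))
    (hF : Within r m O v (inN r v) (mask F))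
    (hneed : (inN r v).card ≤ 1 ∨ need + 2 ≤ (inN r v).card) (hG : OrientTable m O G F)
    (h : orientOK k m O need depth G F = true) : Emb r G (m + 1 + F.length) := by
  classical
  have hin : ∀ z, ∃ t, r z v → HasType r m g t z ∧ t ∈ F := by
    intro z
    by_cases hz : r z v
    · obtain ⟨t, ht⟩ := hg.exists_hasType hT hz
      exact ⟨t, fun _ => ⟨ht, testBit_mask.1 (hF g hg z (mem_inN.2 hz) t ht)⟩⟩
    · exact ⟨0, fun h => absurd h hz⟩
  have hout : ∀ x, ∃ a, r v x → a < m ∧ g a = x := by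
    intro x
    by_cases hx : r v x
    · exact (hg.surj x hx).imp fun a h _ => h
    · exact ⟨0, fun h => absurd h hx⟩
  choose τ hτ using hin
  choose α hα using hout
  have hτB : Set.InjOn τ (inN r v) := by
    intro z hz z' hz' e
    exact hsep.eq hT hg hz hz' (hτ z (mem_inN.1 hz)).1 (e ▸ (hτ z' (mem_inN.1 hz')).1)
  have hlt : ∀ z, r z v → F.idxOf (τ z) < F.length := fun z hz =>
    List.idxOf_lt_length_iff.2 (hτ z hz).2
  have hcase : ∀ x, x = v ∨ r v x ∨ r x v := fun x => by
    by_cases hx : x = v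
    · exact Or.inl hx
    · exact Or.inr (tot_of_isTournament hT _ _ (Ne.symm hx))
  set φ : V → ℕ := fun x => if x = v then m else if r v x then α x else m + 1 + F.idxOf (τ x)
  have h1 : φ v = m := if_pos rfl
  have h2 : ∀ x, r v x → φ x = α x := fun x hx => by
    have hne : x ≠ v := fun e => hT.1 v (e ▸ hx)
    simp only [φ, if_neg hne, if_pos hx]
  have h3 : ∀ x, r x v → φ x = m + 1 + F.idxOf (τ x) := fun x hx => by
    have hne : x ≠ v := fun e => hT.1 v (e ▸ hx)
    simp only [φ, if_neg hne, if_neg (asymm_of_isTournament hT hx)]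
  refine ⟨φ, ?_, ?_, ?_⟩
  · intro x y e
    rcases hcase x with rfl | hx | hx <;> rcases hcase y with rfl | hy | hy
    · rfl
    · rw [h1, h2 y hy] at e
      have := (hα y hy).1
      omega
    · rw [h1, h3 y hy] at e
      omega
    · rw [h1, h2 x hx] at e
      have := (hα x hx).1
      omega
    · rw [h2 x hx, h2 y hy] at e
      rw [← (hα x hx).2, ← (hα y hy).2, e]
    · rw [h2 x hx, h3 y hy] at e
      have := (hα x hx).1
      omega
    · rw [h1, h3 x hx] at e
      omega
    · rw [h3 x hx, h2 y hy] at e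
      have := (hα y hy).1
      omega
    · rw [h3 x hx, h3 y hy] at e
      exact hτB (mem_inN.2 hx) (mem_inN.2 hy) ((List.idxOf_inj (hτ x hx).2).1 (by omega))
  · intro x
    rcases hcase x with rfl | hx | hx
    · rw [h1]
      omega
    · rw [h2 x hx]
      have := (hα x hx).1
      omega
    · rw [h3 x hx]
      have := hlt x hx
      omega
  · intro x y hxy
    rcases hcase x with rfl | hx | hx <;> rcases hcase y with rfl | hy | hy
    · exact absurd hxy (hT.1 _)
    · rw [h1, h2 y hy]
      exact (hG.1 _ (hα y hy).1).1
    · exact absurd hxy (asymm_of_isTournament hT hy)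
    · exact absurd hxy (asymm_of_isTournament hT hx)
    · rw [h2 x hx, h2 y hy]
      obtain ⟨h4, h5⟩ := hα x hx
      obtain ⟨h6, h7⟩ := hα y hy
      refine ((hG.1 _ h4).2 _ h6 fun e => ?_).resolve_right fun hO => ?_
      · rw [← h5, ← h7, e] at hxy
        exact hT.1 _ hxy
      · have := (hg.arcs _ (h6.trans (by omega)) _ (h4.trans (by omega)) (by
          rw [Nat.testBit_shiftLeft, ← hO, decide_eq_true (by omega), Bool.true_and]
          congr 1
          omega)).2.2
        rw [h5, h7] at this
        exact asymm_of_isTournament hT hxy this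
    · rw [h2 x hx, h3 y hy]
      obtain ⟨h4, h5⟩ := hα x hx
      have := (hG.2 _ (hlt y hy)).2 _ h4
      rwa [List.getElem_idxOf, if_neg] at this
      rw [← (hτ y hy).1.rel_iff hT h4, h5]
      exact asymm_of_isTournament hT hxy
    · rw [h3 x hx, h1]
      exact (hG.2 _ (hlt x hx)).1
    · rw [h3 x hx, h2 y hy]
      obtain ⟨h4, h5⟩ := hα y hy
      have := (hG.2 _ (hlt x hx)).2 _ h4
      rwa [List.getElem_idxOf, if_pos] at this
      rwa [← (hτ x hx).1.rel_iff hT h4, h5]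
    · rw [h3 x hx, h3 y hy]
      refine edge_ne_zero fun h0 => ?_
      have hneed' : need + 2 ≤ (inN r v).card := by
        refine hneed.resolve_left fun hcard => ?_
        have := Finset.card_le_one.1 hcard x (mem_inN.2 hx) y (mem_inN.2 hy)
        exact hT.1 _ (this ▸ hxy)
      have := orientRow_eq_false (B := inN r v) hT hK hm hg (fun z hz => hτ z (mem_inN.1 hz)) hτB
        hneed' (mem_inN.2 hx) (mem_inN.2 hy) hxy h0
      rw [orientOK_eq_false (hlt x hx) (by rwa [List.getElem_idxOf])] at h
      cases h

/-- The base with 1 vertex. -/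
def base1 : ℕ :=
  4294967296

/-- The base with 3 vertices. -/
def base3 : ℕ :=
  554597137636743851306521722884

/-- The base with 6 vertices. -/
def base6 : ℕ :=
  395457409343975904508915339888432906682131769669409296089124

/-- The base with 7 vertices. -/
def base7 : ℕ :=
  3423913226903890102621689098615333592393117753075044147471581150445668

/-- The base with 12 vertices. -/
def base12 : ℕ :=
  161351215384592832125102018039110444762551174462637190861810266562034805504567817823211347798647781633622500671758534436

/-- The base with 13 vertices. -/
def base13 : ℕ :=
  1386165616762106238867890960162693541941916834375442882897112507140316166728191255842237012469337841537927940523848209696857003812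

/-- The table of the tournament with 3 vertices. -/
def graph3 : ℕ :=
  36893488151714070532

/-- The table of the tournament with 7 vertices. -/
def graph7 : ℕ :=
  175758848698978182563840496841200411412391442371422648795236

/-- The table of the tournament with 13 vertices. -/
def graph13 : ℕ :=
  29709112720015558410008079609894368286373451304009586924595760707934940026781057855140619602153318393424829762095814436

/-- The table of the tournament with 27 vertices. -/
def graph27 : ℕ :=
  1331610514570453910519072356841415390353584657184341576350602620570849876195778855011265567075418814637967637025356855918917105205858671963760779654919626514145434517241281294606004488200087165375777393080676291052102378909651195831183282668054828320136533796

/-- The table of the subtournament of `graph27` without the vertex `12`. -/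
def graph26 : ℕ :=
  155015759104957868584159723835700293681151465470289143091765849294385460030241776334725196586154812289014088313710722375334113631309758674619615221503493460576224350818018049065713206944335359217259271049567952065254969719759913092458238589327066916

/-- Packed automorphisms of `base3`. -/
def auts3 : List ℕ := [2080, 65, 1026]

/-- Packed automorphisms of `base6`. -/
def auts6 : List ℕ := [172066848, 3215521, 35785733]

/-- Packed automorphisms of `base7`. -/
def auts7 : List ℕ := [6614517792, 2349995104, 5439002752, 4501635137, 136484961, 6445666465,
  5509317634, 1241714786, 4331672770, 38996099, 1147273379, 2151843011, 107025444, 5369957444,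
  3391127748, 6478236677, 1178605637, 3422618757, 2253426694, 4362243110, 3356493990]

/-- Packed automorphisms of `base12`. -/
def auts12 : List ℕ := [407901468851537952, 2475143785155816, 291784041964841099]

/-- Packed automorphisms of `base13`. -/
def auts13 : List ℕ := [14242959524133701664, 11575801564466877536, 10498248217708241248,
  9415166656851968065, 12943707487150870689, 11613939130163176673, 4947393417639560194,
  11534986632116874434, 5985648121264222498, 2604249515143921827, 10557634184141353155,
  1371676287926705411, 3828071859741725732, 9259512306900212932, 219839964957945156,
  8513222050165427205, 10385550538509255813, 9375686363776559493, 6160961993722695910,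
  1590900151590029670, 253508151210773894, 13008648805921464423, 2414325580977969287,
  156577470829659431, 7291408099822513160, 13837533199067319528, 2565225672033183048,
  7218296210460122153, 5051176214819023113, 12722887853555845513, 7249783851652067498,
  3862087403885994282, 8254196587497296234, 3608942725767108683, 14126842097247004811,
  5850288308077330699, 8435282792798069836, 4685125985438603372, 1269036907837330764]

/-- The types over `base3` of the vertices outside of it. -/
def types3 : List ℕ := [1, 2, 4]

/-- The types over `base6` of the vertices outside of it. -/
def types6 : List ℕ := [7, 12, 20, 24, 41, 50]

/-- The types over `base12` of the vertices outside of it. -/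
def types12 : List ℕ := [693, 858, 1365, 1644, 2350, 3298, 3721, 481, 1051, 1414, 2204, 2627,
  2864]

/-- The types over `base13` of the vertices outside of it. -/
def types13 : List ℕ := [693, 858, 1365, 1644, 2350, 3298, 3721, 4577, 5147, 5510, 6300, 6723,
  6960]

/-- The members of `types12` with at least six elements. -/
def large12 : List ℕ := [693, 858, 1365, 1644, 2350, 3298, 3721]

/-- Types over `base6` that meet the orbits of those to be refuted. -/
def reps6 : List ℕ := [0, 1, 4, 5, 3, 6, 35, 10, 21, 28]

/-- Types over `base7` that meet the orbits of those to be refuted. -/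
def reps7 : List ℕ := [0, 1, 3, 21, 7]

/-- Types over `base12` that meet the orbits of those to be refuted. -/
def reps12 : List ℕ := [1929, 3341, 918, 2319, 183, 969, 2343, 2347, 2349, 303, 1083, 567, 679,
  489, 694, 474, 691, 754, 63, 2375]

/-- Types over `base13` that meet the orbits of those to be refuted. -/
def reps13 : List ℕ := [0, 1, 10, 164, 28, 3, 14, 166, 11, 21, 74, 35, 19, 13, 99, 284, 149,
  150, 92, 165, 147, 172, 156, 85, 27, 7, 15, 29, 39, 181, 236, 285, 286, 167, 151, 209, 179,
  23, 302, 220, 310, 183, 918, 303, 47, 31, 695, 63]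

/-- Types over `base12` with five elements that are to be refuted. -/
def small12 : List ℕ := [31, 47, 55, 59, 61, 62, 151, 167, 179, 181, 182, 218, 220, 233, 236,
  242, 271, 285, 286, 295, 299, 301, 302, 310, 327, 341, 346, 355, 361, 370, 406, 410, 412, 425,
  428, 457, 458, 466, 472, 488, 535, 542, 551, 563, 565, 566, 569, 572, 583, 602, 611, 617, 620,
  626, 647, 659, 661, 662, 666, 675, 677, 678, 689, 690, 692, 713, 714, 721, 722, 728, 737, 738,
  752, 790, 793, 794, 820, 841, 842, 849, 850, 856, 880, 902, 905, 906, 914, 916, 920, 932, 961,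
  962, 968, 976, 992, 1039, 1053, 1067, 1075, 1081, 1082, 1084, 1095, 1109, 1123, 1129, 1132,
  1138, 1159, 1171, 1173, 1187, 1201, 1202, 1204, 1225, 1226, 1228, 1233, 1234, 1236, 1249,
  1250, 1252, 1264, 1293, 1294, 1301, 1332, 1349, 1350, 1361, 1364, 1380, 1392, 1417, 1418,
  1420, 1550, 1561, 1580, 1592, 1606, 1609, 1610, 1612, 1636, 1640, 1670, 1673, 1674, 1798,
  1801, 1802, 1809, 1828, 1840, 1857, 1858, 1888, 1921, 1922, 1924, 1928, 2063, 2087, 2091,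
  2093, 2094, 2119, 2133, 2138, 2140, 2162, 2202, 2213, 2217, 2220, 2226, 2250, 2252, 2258,
  2260, 2264, 2274, 2276, 2288, 2311, 2315, 2317, 2318, 2325, 2339, 2341, 2342, 2345, 2346,
  2348, 2371, 2373, 2374, 2385, 2388, 2402, 2404, 2416, 2441, 2465, 2472, 2567, 2574, 2595,
  2597, 2598, 2601, 2604, 2629, 2630, 2634, 2636, 2641, 2648, 2658, 2660, 2672, 2697, 2698,
  2721, 2722, 2825, 2833, 2945, 2952, 2976, 3085, 3093, 3098, 3100, 3122, 3141, 3153, 3154,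
  3156, 3170, 3184, 3205, 3209, 3210, 3212, 3218, 3220, 3234, 3248, 3266, 3268, 3280, 3296,
  3333, 3337, 3338, 3340, 3345, 3348, 3376, 3393, 3394, 3396, 3408, 3424, 3457, 3464, 3593,
  3601, 3608, 3632, 3713, 3720, 3841, 3848, 3856, 3872, 3968]

/-- Packed automorphisms of `graph27` that move every vertex to `0`. -/
def moves27 : List ℕ := [36485634846548906633991799739614356408352,
  36005734331190267470888373254230013838338, 36183610376215245310908332108018023104577,
  17114028202515324961486556103353804269826, 27611531035731131065021142025674695140546,
  28063765854219891187013158976509598306465, 26430607149716924133135624374166383836418,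
  35756720111691470381594297647219734724130, 22779836510886386263292219701996233598177,
  22343428732346116603427676883411197976673, 23363359532909707956270606515548686006497,
  30652809830786128656988709483170642570434, 28896769922833040323084894616662318364737,
  27554042876617607145791755752589865267746, 2398104785239454035715961701292817192034,
  13894187548138994330058413529641371937953, 5814842168144172791625705572568213760194,
  11421562351528551150825462360568567146721, 15135263165823961429419441651557371289665,
  32766567892940760588973085395698658261153, 35943844037410214156792080362981678665826,
  16623513565625122073701936916938722028642, 35084100785618928951816536806144967203362,
  28857565185071263445116649018821902640865, 13186365920510891101053757508103478354017,
  14997908333187969404080020636063293146370, 234383192453701085094146462425760043105]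

/-- Packed automorphisms of `graph27` that fix `0` and move its out-neighbours to `2`. -/
def turns27 : List ℕ := [36485634846548906633991799739614356408352,
  24010958334234595371251740384287680143712, 32267742392881776370780221038717404812384,
  31866025553089682759785355214160963058880, 26346022776267845812715655997029604280416,
  32807649016295718933047218712101537400864, 13932724727336337419342204000665496855904,
  16534982022084766421651416837260755806304, 12540902211016871835117591111247525097504,
  20473867130665697513612051612421667932512, 32988890453401666370565755362881851299520,
  7489295572182848599875704590359982354624, 3221167409208259843889133613525441618112]

section

set_option maxRecDepth 100000

theorem isAut_auts3 : ∀ s ∈ auts3, IsAut 3 base3 s := by decide +kernel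
theorem isAut_auts6 : ∀ s ∈ auts6, IsAut 6 base6 s := by decide +kernel
theorem isAut_auts7 : ∀ s ∈ auts7, IsAut 7 base7 s := by decide +kernel
theorem isAut_auts12 : ∀ s ∈ auts12, IsAut 12 base12 s := by decide +kernel
theorem isAut_auts13 : ∀ s ∈ auts13, IsAut 13 base13 s := by decide +kernel
theorem isAut_graph7 : ∀ s ∈ auts7, IsAut 7 graph7 s := by decide +kernel
theorem isAut_graph13 : ∀ s ∈ auts13, IsAut 13 graph13 s := by decide +kernel
theorem isAut_moves27 : ∀ s ∈ moves27, IsAut 27 graph27 s := by decide +kernel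
theorem isAut_turns27 : ∀ s ∈ turns27, IsAut 27 graph27 s := by decide +kernel

theorem trans_auts7 : ∀ u < 7, ∃ s ∈ auts7, entry s u = 6 := by decide +kernel
theorem trans_auts13 : ∀ u < 13, ∃ s ∈ auts13, entry s u = 12 := by decide +kernel
theorem trans_moves27 : ∀ u < 27, ∃ s ∈ moves27, entry s u = 0 := by decide +kernel
theorem trans_turns27 : ∀ u < 27, graph27.testBit u = true →
    ∃ s ∈ turns27, entry s 0 = 0 ∧ entry s u = 2 := by decide +kernel

theorem baseTable_base1 : BaseTable 1 base1 0 := by decide +kernel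
theorem baseTable_base3 : BaseTable 3 base3 graph3 := by decide +kernel
theorem baseTable_base6 : BaseTable 6 base6 graph7 := by decide +kernel
theorem baseTable_base7 : BaseTable 7 base7 graph7 := by decide +kernel
theorem baseTable_base12 : BaseTable 12 base12 graph13 := by decide +kernel
theorem baseTable_base13 : BaseTable 13 base13 graph13 := by decide +kernel

theorem orientTable_graph3 : OrientTable 1 base1 graph3 [0] := by decide +kernel
theorem orientTable_graph7 : OrientTable 3 base3 graph7 types3 := by decide +kernel
theorem orientTable_graph13 : OrientTable 6 base6 graph13 types6 := by decide +kernel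
theorem orientTable_graph26 : OrientTable 12 base12 graph26 types12 := by decide +kernel
theorem orientTable_graph27 : OrientTable 13 base13 graph27 types13 := by decide +kernel

theorem start_base1 : start 4 1 1 base1 = mask [0] := by decide +kernel

theorem stagesOK_base3 : stagesOK 16 2 3 base3 1 1 auts3 [0] (start 16 2 3 base3) = true := by
  decide +kernel

theorem stage_base3 : stage 3 auts3 [0] (start 16 2 3 base3) = mask types3 := by decide +kernel

theorem stagesOK_base6 :
    stagesOK 128 3 6 base6 4 4 auts6 reps6 (start 128 3 6 base6) = true := by
  decide +kernel

theorem stage_base6 : stage 6 auts6 reps6 (start 128 3 6 base6) = mask types6 := by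
  decide +kernel

theorem stagesOK_base7 :
    stagesOK 256 3 7 base7 3 3 auts7 reps7 (start 256 3 7 base7) = true := by
  decide +kernel

theorem stage_base7 : stage 7 auts7 reps7 (start 256 3 7 base7) = 0 := by decide +kernel

theorem orientOK_graph3 : orientOK 1 1 base1 0 0 graph3 [0] = true := by decide +kernel
theorem orientOK_graph7 : orientOK 2 3 base3 0 1 graph7 types3 = true := by decide +kernel
theorem orientOK_graph13 : orientOK 3 6 base6 3 3 graph13 types6 = true := by decide +kernel
theorem orientOK_graph26 : orientOK 4 12 base12 10 3 graph26 types12 = true := by decide +kernel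
theorem orientOK_graph27 : orientOK 4 13 base13 9 3 graph27 types13 = true := by decide +kernel

theorem embed_graph26 : ∀ a < 26, ∀ b < 26, graph26.testBit (32 * a + b) = true →
    graph27.testBit (32 * (if a < 12 then a else a + 1) + if b < 12 then b else b + 1) = true := by
  decide +kernel

theorem asymm_graph27 : ∀ a < 27, ∀ b < 27, graph27.testBit (32 * a + b) = true →
    graph27.testBit (32 * b + a) = false := by
  decide +kernel

theorem card_graph13 : ((Finset.range 12).filter fun a =>
    ((Finset.range 12).filter fun b => graph13.testBit (32 * a + b) = true).card = 5).card = 6 ∧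
    ∀ a < 12, ((Finset.range 12).filter fun b => graph13.testBit (32 * a + b) = true).card = 5 ∨
      ((Finset.range 12).filter fun b => graph13.testBit (32 * a + b) = true).card = 6 := by
  decide +kernel

theorem asymm_graph13 : ∀ a < 13, ∀ b < 13, graph13.testBit (32 * a + b) = true →
    graph13.testBit (32 * b + a) = false := by
  decide +kernel

theorem large12_subset : ∀ t ∈ large12, t ∈ types12 := by decide +kernel

theorem stage_layer_base12 : stage 12 auts12 reps12
    (startLayer 8192 4 12 base12 6) = mask large12 := by
  decide +kernel

theorem layer_base12 : diff (startLayer 8192 4 12 base12 5)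
    (mask (small12 ++ types12)) = 0 := by
  decide +kernel

end

section

set_option maxRecDepth 100000

/-- Four consecutive entries of `reps13`. -/
def block13 (i : ℕ) : List ℕ := (reps13.drop (4 * i)).take 4

/-- The types that remain after the first `i` blocks of `reps13` have been refuted. -/
def left13 : ℕ → ℕ :=
  Nat.rec (start 16384 4 13 base13) fun i P => stage 13 auts13 (block13 i) P

/-- The check of the `i`-th block of `reps13`. -/
def check13 (i : ℕ) : Bool :=
  force (left13 i) fun P => stagesOK 16384 4 13 base13 10 5 auts13 (block13 i) P

theorem check13_0 : check13 0 = true := by decide +kernel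
theorem check13_1 : check13 1 = true := by decide +kernel
theorem check13_2 : check13 2 = true := by decide +kernel
theorem check13_3 : check13 3 = true := by decide +kernel
theorem check13_4 : check13 4 = true := by decide +kernel
theorem check13_5 : check13 5 = true := by decide +kernel
theorem check13_6 : check13 6 = true := by decide +kernel
theorem check13_7 : check13 7 = true := by decide +kernel
theorem check13_8 : check13 8 = true := by decide +kernel
theorem check13_9 : check13 9 = true := by decide +kernel
theorem check13_10 : check13 10 = true := by decide +kernel
theorem check13_11 : check13 11 = true := by decide +kernel

theorem left13_eq : left13 12 = mask types13 := by decide +kernel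

/-- The check of the `i`-th block of `36` entries of `small12`. -/
def check12 (i : ℕ) : Bool :=
  rootsOK 8192 4 12 base12 6 5 (mask large12) ((small12.drop (36 * i)).take 36)

theorem check12_0 : check12 0 = true := by decide +kernel
theorem check12_1 : check12 1 = true := by decide +kernel
theorem check12_2 : check12 2 = true := by decide +kernel
theorem check12_3 : check12 3 = true := by decide +kernel
theorem check12_4 : check12 4 = true := by decide +kernel
theorem check12_5 : check12 5 = true := by decide +kernel
theorem check12_6 : check12 6 = true := by decide +kernel
theorem check12_7 : check12 7 = true := by decide +kernel

theorem mem_small12 : ∀ t ∈ small12, ∃ i < 8, t ∈ (small12.drop (36 * i)).take 36 := by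
  decide +kernel

theorem stagesOK_base12 : stagesOK 8192 4 12 base12 5 5 auts12 reps12
    (startLayer 8192 4 12 base12 6) = true := by
  decide +kernel

end

section

variable {V : Type} [Fintype V] {r : V → V → Prop}

theorem ramseyBound_two : RamseyBound 2 1 := ramseyBound_one.step

theorem ramseyBound_three : RamseyBound 3 3 := ramseyBound_two.step

theorem ramseyBound_four : RamseyBound 4 7 := ramseyBound_three.step

theorem emb_graph3 (hT : IsTournament r) (hK : Free r 3) (hV : Fintype.card V = 3) :
    Emb r graph3 3 := by
  classical
  have : Nonempty V := Fintype.card_pos_iff.1 (by omega)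
  obtain ⟨v, hv⟩ := exists_card_le_outN hT
  have h1 := ramseyBound_two.card_outN_le hT hK v
  have h2 := card_outN_add_card_inN hT v
  have hA : (outN r v).card = 1 := by omega
  have hE : Emb (fun x y : {x // r v x} => r x y) 0 1 := by
    rw [card_outN] at hA
    have := Fintype.card_le_one_iff_subsingleton.1 hA.le
    refine ⟨fun _ => 0, fun x y _ => Subsingleton.elim x y, fun _ => Nat.one_pos, ?_⟩
    intro x y h
    rw [Subsingleton.elim x y] at h
    exact absurd h (hT.1 _)
  obtain ⟨g, hg⟩ := exists_isBase hT hA hE baseTable_base1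
  refine emb_of_base (k := 1) (F := [0]) hT hK (by omega) hg ⟨fun z hz => mem_inN.1 hz, ?_⟩ ?_
    (Or.inl (by omega)) orientTable_graph3 orientOK_graph3
  · intro z hz z' hz' _
    exact Finset.card_le_one.1 (by omega) z hz z' hz'
  · rw [← start_base1]
    exact within_start hK (by norm_num) (by norm_num)

theorem emb_graph7 (hT : IsTournament r) (hK : Free r 4) (hV : Fintype.card V = 6 ∨ Fintype.card V = 7) :
    Emb r graph7 7 := by
  classical
  have : Nonempty V := Fintype.card_pos_iff.1 (by omega)
  obtain ⟨v, hv⟩ := exists_card_le_outN hT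
  have h1 := ramseyBound_three.card_outN_le hT hK v
  have h2 := card_outN_add_card_inN hT v
  have hA : (outN r v).card = 3 := by omega
  obtain ⟨g, hg⟩ := exists_isBase hT hA
    (emb_graph3 (isTournament_sub hT _) (free_out hK v) (card_outN v ▸ hA)) baseTable_base3
  have hsep : Separated r v (inN r v) :=
    separated_inN (k := 1) hT hK ramseyBound_one ramseyBound_two (by omega)
  refine emb_of_base (k := 2) hT hK (by omega) hg hsep ?_ (Or.inr (by omega))
    orientTable_graph7 orientOK_graph7
  rw [← stage_base3]
  exact (within_start hK (by norm_num) (by norm_num)).stage hT hK (by norm_num) (by norm_num) hsep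
    isAut_auts3 (by decide) (by omega) stagesOK_base3

theorem card_inN_le_of_card_outN_eq_seven (hT : IsTournament r) (hK : Free r 5) {v : V}
    (hA : (outN r v).card = 7) : (inN r v).card ≤ 3 := by
  classical
  by_contra! hB
  obtain ⟨g, hg⟩ := exists_isBase hT hA
    (emb_graph7 (isTournament_sub hT _) (free_out hK v) (Or.inr (card_outN v ▸ hA))) baseTable_base7
  have hsep : Separated r v (inN r v) :=
    separated_inN (k := 2) hT hK ramseyBound_two ramseyBound_three (by omega)
  have hW := (within_start (k := 3) (S := 256) (m := 7) (O := base7) (v := v) (B := inN r v) hK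
    (by norm_num) (by norm_num)).stage hT hK (by norm_num) (by norm_num) hsep
    isAut_auts7 (by decide) (by omega) stagesOK_base7
  rw [stage_base7] at hW
  obtain ⟨z, hz⟩ : (inN r v).Nonempty := Finset.card_pos.1 (by omega)
  obtain ⟨t, ht⟩ := hg.exists_hasType hT (mem_inN.1 hz)
  simpa using hW g hg z hz t ht

theorem ramseyBound_five : RamseyBound 5 13 := by
  intro V _ r hT hK
  by_contra! hV
  have : Nonempty V := Fintype.card_pos_iff.1 (by omega)
  obtain ⟨v, hv⟩ := exists_card_le_outN hT
  have h1 := ramseyBound_four.card_outN_le hT hK v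
  have h2 := card_outN_add_card_inN hT v
  have h3 := card_inN_le_of_card_outN_eq_seven hT hK (v := v) (by omega)
  omega

theorem emb_graph13 (hT : IsTournament r) (hK : Free r 5)
    (hV : Fintype.card V = 12 ∨ Fintype.card V = 13) : Emb r graph13 13 := by
  classical
  have : Nonempty V := Fintype.card_pos_iff.1 (by omega)
  obtain ⟨v, hv⟩ := exists_card_le_outN hT
  have h1 := ramseyBound_four.card_outN_le hT hK v
  have h2 := card_outN_add_card_inN hT v
  have h3 := card_inN_le_of_card_outN_eq_seven hT hK (v := v)
  have hA : (outN r v).card = 6 := by omega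
  have hA' := card_outN (r := r) v ▸ hA
  obtain ⟨g, hg⟩ := exists_isBase hT hA
    ((emb_graph7 (isTournament_sub hT _) (free_out hK v) (Or.inl hA')).pred hA'.le isAut_graph7
      trans_auts7) baseTable_base6
  have hsep : Separated r v (inN r v) :=
    separated_inN (k := 2) hT hK ramseyBound_two ramseyBound_three (by omega)
  refine emb_of_base (k := 3) hT hK (by omega) hg hsep ?_ (Or.inr (by omega))
    orientTable_graph13 orientOK_graph13
  rw [← stage_base6]
  exact (within_start hK (by norm_num) (by norm_num)).stage hT hK (by norm_num) (by norm_num) hsep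
    isAut_auts6 (by decide) (by omega) stagesOK_base6

theorem emb_graph27_of_card_outN_eq (hT : IsTournament r) (hK : Free r 6)
    (hV : Fintype.card V = 25) {v : V} (hA : (outN r v).card = 13) : Emb r graph27 27 := by
  classical
  have h2 := card_outN_add_card_inN hT v
  obtain ⟨g, hg⟩ := exists_isBase hT hA
    (emb_graph13 (isTournament_sub hT _) (free_out hK v) (Or.inr (card_outN v ▸ hA)))
    baseTable_base13
  have hsep : Separated r v (inN r v) :=
    separated_inN (k := 3) hT hK ramseyBound_three ramseyBound_four (by omega)
  refine emb_of_base (k := 4) hT hK (by omega) hg hsep ?_ (Or.inr (by omega))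
    orientTable_graph27 orientOK_graph27
  have step : ∀ i, check13 i = true → Within r 13 base13 v (inN r v) (left13 i) →
      Within r 13 base13 v (inN r v) (left13 (i + 1)) := by
    intro i hi hW
    rw [check13, force_eq] at hi
    refine hW.stage hT hK (by norm_num) (by norm_num) hsep isAut_auts13 ?_ (by omega) hi
    intro t ht
    exact (by decide : ∀ t ∈ reps13, t < 2 ^ 13) t (List.mem_of_mem_drop (List.mem_of_mem_take ht))
  rw [← left13_eq]
  refine step 11 check13_11 <| step 10 check13_10 <| step 9 check13_9 <| step 8 check13_8 <|
    step 7 check13_7 <| step 6 check13_6 <| step 5 check13_5 <| step 4 check13_4 <|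
    step 3 check13_3 <| step 2 check13_2 <| step 1 check13_1 <| step 0 check13_0 ?_
  exact within_start hK (by norm_num) (by norm_num)

end

section

variable {V : Type} [Fintype V] {r : V → V → Prop}

open Classical in
theorem IsBase.card_type {m O t : ℕ} {v z : V} {g : ℕ → V} (hT : IsTournament r)
    (hg : IsBase r m O v g) (hA : (outN r v).card = m) (ht : HasType r m g t z) :
    ((Finset.range m).filter fun a => t.testBit a = true).card =
      ((outN r v).filter fun x => r z x).card := by
  have hinj : Set.InjOn g (Finset.range m) := by
    refine Finset.injOn_of_surjOn_of_card_le g (t := outN r v) ?_ ?_ (by simp [hA])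
    · intro a ha
      exact mem_outN.2 (hg.out a (by simpa using ha))
    · intro x hx
      obtain ⟨a, ha, rfl⟩ := hg.surj x (mem_outN.1 hx)
      exact ⟨a, by simpa using ha, rfl⟩
  rw [← Finset.card_image_of_injOn (hinj.mono (Finset.filter_subset _ _))]
  congr 1
  ext x
  simp only [Finset.mem_image, Finset.mem_filter, Finset.mem_range, mem_outN]
  constructor
  · rintro ⟨a, ⟨ha, h⟩, rfl⟩
    exact ⟨hg.out a ha, (ht.rel_iff hT ha).2 h⟩
  · rintro ⟨h1, h2⟩
    obtain ⟨a, ha, rfl⟩ := hg.surj x h1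
    exact ⟨a, ⟨ha, (ht.rel_iff hT ha).1 h2⟩, rfl⟩

open Classical in
theorem card_outN_eq_of_rel (hT : IsTournament r) {v z : V} (hz : r z v) :
    (outN r z).card = ((outN r v).filter fun x => r z x).card +
      ((inN r v).filter fun x => r z x).card + 1 := by
  have h1 : Disjoint ((outN r v).filter fun x => r z x) ((inN r v).filter fun x => r z x) := by
    rw [Finset.disjoint_left]
    simp only [Finset.mem_filter, mem_outN, mem_inN]
    exact fun x hx hx' => asymm_of_isTournament hT hx.1 hx'.1
  rw [← Finset.card_union_of_disjoint h1,
    ← Finset.card_insert_of_notMem (a := v) (by simp [mem_outN, mem_inN, hT.1 v])]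
  congr 1
  ext x
  simp only [Finset.mem_insert, Finset.mem_union, Finset.mem_filter, mem_outN, mem_inN]
  constructor
  · intro h
    by_cases hx : x = v
    · exact Or.inl hx
    · exact Or.inr ((tot_of_isTournament hT _ _ (Ne.symm hx)).imp (⟨·, h⟩) (⟨·, h⟩))
  · rintro (rfl | h | h)
    exacts [hz, h.2, h.2]

open Classical in
theorem card_inN_degrees {v : V} (hT : IsTournament r)
    (hE : Emb (fun x y : {x // r x v} => r x y) graph13 12) (hB : (inN r v).card = 12) :
    ((inN r v).filter fun z => ((inN r v).filter fun x => r z x).card = 5).card = 6 ∧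
    ∀ z ∈ inN r v, ((inN r v).filter fun x => r z x).card = 5 ∨
      ((inN r v).filter fun x => r z x).card = 6 := by
  obtain ⟨φ, h1, h2, h3⟩ := hE
  set ψ : V → ℕ := fun x => if h : r x v then φ ⟨x, h⟩ else 0 with hψ
  have hψ' : ∀ x (h : r x v), ψ x = φ ⟨x, h⟩ := fun x h => dif_pos h
  have hinj : Set.InjOn ψ (inN r v) := by
    intro x hx y hy e
    have hx := mem_inN.1 hx
    have hy := mem_inN.1 hy
    rw [hψ' x hx, hψ' y hy] at e
    exact congrArg Subtype.val (h1 e)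
  have himg : (inN r v).image ψ = Finset.range 12 := by
    refine Finset.eq_of_subset_of_card_le ?_ ?_
    · intro b hb
      obtain ⟨x, hx, rfl⟩ := Finset.mem_image.1 hb
      rw [Finset.mem_range, hψ' x (mem_inN.1 hx)]
      exact h2 _
    · rw [Finset.card_image_of_injOn hinj, hB, Finset.card_range]
  have hlt : ∀ x ∈ inN r v, ψ x < 12 := fun x hx =>
    Finset.mem_range.1 (himg ▸ Finset.mem_image_of_mem ψ hx)
  have hrel : ∀ x ∈ inN r v, ∀ y ∈ inN r v,
      (r x y ↔ graph13.testBit (32 * ψ x + ψ y) = true) := by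
    have key : ∀ x ∈ inN r v, ∀ y ∈ inN r v, r x y → graph13.testBit (32 * ψ x + ψ y) = true := by
      intro x hx y hy h
      rw [hψ' x (mem_inN.1 hx), hψ' y (mem_inN.1 hy)]
      exact h3 _ _ h
    intro x hx y hy
    refine ⟨key x hx y hy, fun h => ?_⟩
    have h' := asymm_graph13 _ ((hlt x hx).trans (by norm_num)) _ ((hlt y hy).trans (by norm_num)) h
    refine (tot_of_isTournament hT x y ?_).resolve_right fun hyx => ?_
    · rintro rfl
      rw [h'] at h
      cases h
    · rw [key y hy x hx hyx] at h'
      cases h'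
  have hd : ∀ z ∈ inN r v, ((inN r v).filter fun x => r z x).card =
      ((Finset.range 12).filter fun b => graph13.testBit (32 * ψ z + b) = true).card := by
    intro z hz
    rw [← himg, Finset.filter_image,
      Finset.card_image_of_injOn (hinj.mono (Finset.filter_subset _ _))]
    exact congrArg _ (Finset.filter_congr fun x hx => hrel z hz x hx)
  constructor
  · rw [← card_graph13.1, ← himg, Finset.filter_image,
      Finset.card_image_of_injOn (hinj.mono (Finset.filter_subset _ _))]
    refine congrArg _ (Finset.filter_congr fun z hz => ?_)
    rw [hd z hz, himg]
  · intro z hz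
    rw [hd z hz]
    exact card_graph13.2 _ (hlt z hz)

theorem emb_graph27_of_graph26 {V : Type} {r : V → V → Prop} (h : Emb r graph26 26) :
    Emb r graph27 27 := by
  obtain ⟨φ, h1, h2, h3⟩ := h
  refine ⟨fun x => if φ x < 12 then φ x else φ x + 1, fun x y e => h1 ?_, fun x => ?_,
    fun x y hxy => embed_graph26 _ (h2 x) _ (h2 y) (h3 x y hxy)⟩
  · dsimp only at e
    split_ifs at e <;> omega
  · have := h2 x
    dsimp only
    split_ifs <;> omega

theorem emb_graph27_of_regular (hT : IsTournament r) (hK : Free r 6) (hV : Fintype.card V = 25)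
    (hreg : ∀ v, (outN r v).card = 12) : Emb r graph27 27 := by
  classical
  obtain ⟨v⟩ : Nonempty V := Fintype.card_pos_iff.1 (by omega)
  have hA := hreg v
  have hB : (inN r v).card = 12 := by
    have := card_outN_add_card_inN hT v
    omega
  have hA' := card_outN (r := r) v ▸ hA
  have hB' := card_inN (r := r) v ▸ hB
  obtain ⟨g, hg⟩ := exists_isBase hT hA
    ((emb_graph13 (isTournament_sub hT _) (free_out hK v) (Or.inl hA')).pred hA'.le isAut_graph13
      trans_auts13) baseTable_base12
  obtain ⟨hcard, hdeg⟩ := card_inN_degrees hT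
    ((emb_graph13 (isTournament_sub hT _) (free_in hK v) (Or.inl hB')).pred hB'.le isAut_graph13
      trans_auts13) hB
  have hsep : Separated r v (inN r v) :=
    separated_inN (k := 3) hT hK ramseyBound_three ramseyBound_four (by omega)
  have hstart : ∀ B, Within r 12 base12 v B (start 8192 4 12 base12) := fun B =>
    within_start hK (by norm_num) (by norm_num)
  have hout : ∀ z ∈ inN r v, ((outN r v).filter fun x => r z x).card +
      ((inN r v).filter fun x => r z x).card = 11 := by
    intro z hz
    have := card_outN_eq_of_rel hT (mem_inN.1 hz)
    rw [hreg z] at this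
    omega
  set L := (inN r v).filter fun z => ((inN r v).filter fun x => r z x).card = 5
  have hL : L ⊆ inN r v := Finset.filter_subset _ _
  have hsepL := hsep.mono hL
  have hlarge : Within r 12 base12 v L (mask large12) := by
    rw [← stage_layer_base12]
    refine Within.stage hT hK (by norm_num) (by norm_num) hsepL isAut_auts12 (by decide)
      hcard.ge ?_ stagesOK_base12
    intro g hg z hz t ht
    rw [testBit_startLayer, hstart L g hg z hz t ht, Bool.and_true]
    refine testBit_layer ht.1 ?_
    rw [hg.card_type hT hA ht]
    have h1 := hout z (hL hz)
    have h2 := (Finset.mem_filter.1 hz).2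
    omega
  have hall : Within r 12 base12 v (inN r v) (mask types12) := by
    intro g hg z hz t ht
    rw [testBit_mask]
    by_cases hzL : z ∈ L
    · exact large12_subset t (testBit_mask.1 (hlarge g hg z hzL t ht))
    · have h5 : (layer 12 5).testBit t = true := by
        refine testBit_layer ht.1 ?_
        rw [hg.card_type hT hA ht]
        have h1 := hout z hz
        have h2 := (hdeg z hz).resolve_left fun h => hzL (Finset.mem_filter.2 ⟨hz, h⟩)
        omega
      have hmem : t ∈ small12 ++ types12 := by
        rw [← testBit_mask]
        have h0 := congrArg (Nat.testBit · t) layer_base12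
        rw [testBit_diff, testBit_startLayer, h5, hstart _ g hg z hz t ht] at h0
        simpa using h0
      refine (List.mem_append.1 hmem).resolve_left fun hsmall => ?_
      obtain ⟨i, hi, hti⟩ := mem_small12 t hsmall
      have hfalse : check12 i = false :=
        rootsOK_false hT hK (by norm_num) (by norm_num) hsepL hlarge hg ht hzL hcard.ge hti
      have htrue : check12 i = true := by
        interval_cases i
        exacts [check12_0, check12_1, check12_2, check12_3, check12_4, check12_5, check12_6,
          check12_7]
      rw [hfalse] at htrue
      cases htrue
  exact emb_graph27_of_graph26 (emb_of_base (k := 4) hT hK (by omega) hg hsep hall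
    (Or.inr (by omega)) orientTable_graph26 orientOK_graph26)

theorem emb_graph27 (hT : IsTournament r) (hK : Free r 6) (hV : Fintype.card V = 25) :
    Emb r graph27 27 := by
  by_cases h : ∃ v, (outN r v).card = 13
  · obtain ⟨v, hv⟩ := h
    exact emb_graph27_of_card_outN_eq hT hK hV hv
  · push Not at h
    have hle : ∀ v, (outN r v).card ≤ 12 ∧ (outN r v).card + (inN r v).card = 24 := by
      intro v
      have h1 := ramseyBound_five.card_outN_le hT hK v
      have h2 := card_outN_add_card_inN hT v
      have h3 := h v
      omega
    have heq := (Finset.sum_eq_sum_iff_of_le (s := Finset.univ) (f := fun v => (outN r v).card)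
      (g := fun v => (inN r v).card) (fun v _ => by have := hle v; omega)).1 (sum_card_outN r)
    refine emb_graph27_of_regular hT hK hV fun v => ?_
    have h1 := heq v (Finset.mem_univ v)
    have h2 := hle v
    omega

end

section

theorem tot_graph27 : ∀ a < 27, ∀ b < 27, a ≠ b →
    graph27.testBit (32 * a + b) = true ∨ graph27.testBit (32 * b + a) = true := by
  decide +kernel

theorem free_of_not_hasTT {V : Type} {r : V → V → Prop} {k : ℕ} (hT : IsTournament r)
    (h : ¬ HasTT r k) : Free r k := by
  intro l hl
  by_contra hlen
  push Not at hlen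
  have hr : ∀ i j : Fin k, i < j → r (l[k - 1 - i]'(by omega)) (l[k - 1 - j]'(by omega)) :=
    fun i j hij => List.pairwise_iff_getElem.1 hl _ _ _ _ (by omega)
  refine h ⟨fun i => l[k - 1 - i]'(by omega), fun i j hij => ?_, hr⟩
  dsimp only at hij
  rcases lt_trichotomy i j with hlt | heq | hgt
  · exact absurd (hij ▸ hr i j hlt) (hT.1 _)
  · exact heq
  · exact absurd (hij ▸ hr j i hgt) (hT.1 _)

variable {V : Type} [Fintype V] {r : V → V → Prop}

/-- An embedding of a tournament with `25` vertices can be moved away from `0` and `2`. -/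
theorem exists_emb_avoiding (hV : Fintype.card V = 25) (h : Emb r graph27 27) :
    ∃ φ : V → ℕ, Function.Injective φ ∧ (∀ x, φ x ∈ ((Finset.range 27).erase 2).erase 0) ∧
      ∀ x y, r x y → graph27.testBit (32 * φ x + φ y) = true := by
  classical
  obtain ⟨φ, h1, h2, h3⟩ := h
  have hcard : 1 < (Finset.range 27 \ Finset.univ.image φ).card := by
    have := Finset.le_card_sdiff (Finset.univ.image φ) (Finset.range 27)
    rw [Finset.card_image_of_injective _ h1, Finset.card_univ, Finset.card_range] at this
    omega
  obtain ⟨a, ha, b, hb, hab⟩ := Finset.one_lt_card.1 hcard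
  simp only [Finset.mem_sdiff, Finset.mem_range, Finset.mem_image, Finset.mem_univ, true_and,
    not_exists] at ha hb
  obtain ⟨u, w, hu, hw, huw, hu', hw'⟩ : ∃ u w, u < 27 ∧ w < 27 ∧
      graph27.testBit (32 * u + w) = true ∧ (∀ x, φ x ≠ u) ∧ ∀ x, φ x ≠ w := by
    rcases tot_graph27 a ha.1 b hb.1 hab with h | h
    · exact ⟨a, b, ha.1, hb.1, h, ha.2, hb.2⟩
    · exact ⟨b, a, hb.1, ha.1, h, hb.2, ha.2⟩
  obtain ⟨s, hs, hsu⟩ := trans_moves27 u hu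
  have hsA := isAut_moves27 s hs
  have hsw := hsA.2.2 u hu w hw huw
  rw [hsu, mul_zero, zero_add] at hsw
  obtain ⟨t, ht, ht0, ht2⟩ := trans_turns27 _ (hsA.1 w hw) hsw
  have htA := isAut_turns27 t ht
  obtain ⟨h4, h5, h6⟩ := Emb.comp hsA h1 h2 h3
  obtain ⟨h7, h8, h9⟩ := Emb.comp htA h4 h5 h6
  refine ⟨_, h7, fun x => ?_, h9⟩
  simp only [Finset.mem_erase, Finset.mem_range]
  refine ⟨fun h => hu' x ?_, fun h => hw' x ?_, h8 x⟩
  · exact hsA.injOn (h2 x) hu (htA.injOn (h5 x) (hsA.1 u hu) (by rw [hsu, ht0]; exact h))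
  · exact hsA.injOn (h2 x) hw (htA.injOn (h5 x) (hsA.1 w hw) (by rw [ht2]; exact h))

theorem exists_equiv_avoiding (hT : IsTournament r) (hK : ¬ HasTT r 6)
    (hV : Fintype.card V = 25) :
    ∃ e : V ≃ (((Finset.range 27).erase 2).erase 0 : Finset ℕ),
      ∀ x y, r x y ↔ graph27.testBit (32 * (e x : ℕ) + e y) = true := by
  obtain ⟨φ, h1, h2, h3⟩ :=
    exists_emb_avoiding hV (emb_graph27 hT (free_of_not_hasTT hT hK) hV)
  have hinj : Function.Injective fun x => (⟨φ x, h2 x⟩ : (((Finset.range 27).erase 2).erase 0 :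
      Finset ℕ)) := fun x y h => h1 (congrArg Subtype.val h)
  refine ⟨Equiv.ofBijective _ ((Fintype.bijective_iff_injective_and_card _).2
    ⟨hinj, by rw [hV, Fintype.card_coe]; rfl⟩), fun x y => ⟨h3 x y, fun h => ?_⟩⟩
  have hlt : ∀ x, φ x < 27 := fun x =>
    Finset.mem_range.1 (Finset.mem_of_mem_erase (Finset.mem_of_mem_erase (h2 x)))
  have hasymm := asymm_graph27 _ (hlt x) _ (hlt y) h
  by_cases hxy : x = y
  · subst hxy
    exact absurd (hasymm.symm.trans h) Bool.false_ne_true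
  · rcases hT.2 x y hxy with h' | h'
    · exact h'.1
    · exact absurd (hasymm.symm.trans (h3 y x h'.1)) Bool.false_ne_true

end

end TTFree

theorem TT6_free_25_unique :
    ∀ r s : Fin 25 → Fin 25 → Prop,
      IsTournament r → ¬ HasTT r 6 → IsTournament s → ¬ HasTT s 6 →
        ∃ g : Fin 25 → Fin 25, Function.Bijective g ∧
          ∀ u v : Fin 25, r u v ↔ s (g u) (g v) := by
  intro r s hr hr6 hs hs6
  obtain ⟨e, he⟩ := TTFree.exists_equiv_avoiding hr hr6 (Fintype.card_fin 25)
  obtain ⟨f, hf⟩ := TTFree.exists_equiv_avoiding hs hs6 (Fintype.card_fin 25)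
  exact ⟨e.trans f.symm, (e.trans f.symm).bijective, fun u v => by simp [he, hf]⟩
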